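/- arXiv:1905.00385 — 6 statements merged into one kernel-verified Lean document; each statement's English description precedes it below -/
import Mathlib

section
/- Every T ∈ DCS(2,f) has trivial dynamics: for every x ∈ ℝ₊², the orbit (Tᵏx)ₖ≥₀ converges to a fixed point of T. -/
open Set Filter Metric Topology Polynomial

/-- The class 𝓕 of C¹ growth functions `f(z,r)` defined on ℝ₊ × (0,∞),
bundled with the partial derivative `fz = ∂f/∂z`, satisfying
(i) f(r,r) = 1 and ∂f/∂z < 0, and (ii) f(z,r) + z ∂f/∂z(z,r) > 0. -/
structure GrowthF where
  f : ℝ → ℝ → ℝ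
  fz : ℝ → ℝ → ℝ
  smooth : ContDiffOn ℝ 1 (fun p : ℝ × ℝ => f p.1 p.2) (Set.Ici 0 ×ˢ Set.Ioi 0)
  hasDeriv : ∀ z r : ℝ, 0 ≤ z → 0 < r →
    HasDerivWithinAt (fun w => f w r) (fz z r) (Set.Ici 0) z
  pos : ∀ z r : ℝ, 0 ≤ z → 0 < r → 0 < f z r
  unit : ∀ r : ℝ, 0 < r → f r r = 1
  fz_neg : ∀ z r : ℝ, 0 ≤ z → 0 < r → fz z r < 0
  contest : ∀ z r : ℝ, 0 ≤ z → 0 < r → 0 < f z r + z * fz z r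

/-- The nonnegative cone ℝ₊ⁿ. -/
def orthant (n : ℕ) : Set (Fin n → ℝ) := {x | ∀ i, 0 ≤ x i}

/-- The open cone int ℝ₊ⁿ. -/
def intOrthant (n : ℕ) : Set (Fin n → ℝ) := {x | ∀ i, 0 < x i}

/-- The boundary ∂ℝ₊ⁿ = ℝ₊ⁿ \ int ℝ₊ⁿ. -/
def bdryOrthant (n : ℕ) : Set (Fin n → ℝ) := orthant n \ intOrthant n

/-- Fᵢ(x) = fᵢ(rᵢ Σⱼ μᵢⱼ xⱼ, rᵢ). -/
def DCS.F {n : ℕ} (fam : Fin n → GrowthF) (r : Fin n → ℝ) (μ : Fin n → Fin n → ℝ)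
    (i : Fin n) (x : Fin n → ℝ) : ℝ :=
  (fam i).f (r i * ∑ j, μ i j * x j) (r i)

/-- A map T of the class DCS(n,f): Tᵢ(x) = xᵢ fᵢ(rᵢ Σⱼ μᵢⱼ xⱼ, rᵢ) = xᵢ Fᵢ(x). -/
def DCS.map {n : ℕ} (fam : Fin n → GrowthF) (r : Fin n → ℝ) (μ : Fin n → Fin n → ℝ)
    (x : Fin n → ℝ) (i : Fin n) : ℝ :=
  x i * DCS.F fam r μ i x

/-- The Jacobian matrix DT(x): (DT(x))ᵢⱼ = δᵢⱼFᵢ(x) + xᵢ ∂fᵢ/∂z((RUx)ᵢ,rᵢ)·rᵢμᵢⱼ. -/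
def DCS.jac {n : ℕ} (fam : Fin n → GrowthF) (r : Fin n → ℝ) (μ : Fin n → Fin n → ℝ)
    (x : Fin n → ℝ) : Matrix (Fin n) (Fin n) ℝ :=
  Matrix.of fun i j => (if i = j then DCS.F fam r μ i x else 0)
    + x i * (fam i).fz (r i * ∑ k, μ i k * x k) (r i) * (r i * μ i j)

/-- T is permanent: there is a compact positively invariant set `K ⊆ int ℝ₊ⁿ`
absorbing every orbit starting in `int ℝ₊ⁿ`. -/
def Permanent {n : ℕ} (T : (Fin n → ℝ) → (Fin n → ℝ)) : Prop :=
  ∃ K : Set (Fin n → ℝ), IsCompact K ∧ K ⊆ intOrthant n ∧ T '' K ⊆ K ∧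
    ∀ x ∈ intOrthant n, ∃ m : ℕ, 0 < m ∧ ∀ k ≥ m, T^[k] x ∈ K

/-- The one-variable facts about a growth function used in the proof. -/
structure GoodG (f : ℝ → ℝ) (r : ℝ) : Prop where
  rpos : 0 < r
  pos : ∀ z, 0 ≤ z → 0 < f z
  unit : f r = 1
  cont : ContinuousOn f (Set.Ici 0)
  anti : StrictAntiOn f (Set.Ici 0)
  mono : StrictMonoOn (fun z => z * f z) (Set.Ici 0)

theorem GrowthF.good (g : GrowthF) {r : ℝ} (hr : 0 < r) : GoodG (fun z => g.f z r) r := by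
  have hc : ContinuousOn (fun z => g.f z r) (Set.Ici 0) :=
    fun z hz => (g.hasDeriv z r hz hr).continuousWithinAt
  have hd : ∀ z, 0 < z → HasDerivAt (fun z => g.f z r) (g.fz z r) z :=
    fun z hz => (g.hasDeriv z r hz.le hr).hasDerivAt (Ici_mem_nhds hz)
  refine ⟨hr, fun z hz => g.pos z r hz hr, g.unit r hr, hc, ?_, ?_⟩
  · apply strictAntiOn_of_deriv_neg (convex_Ici 0) hc
    intro z hz
    rw [interior_Ici] at hz
    rw [(hd z hz).deriv]
    exact g.fz_neg z r (le_of_lt hz) hr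
  · apply strictMonoOn_of_deriv_pos (convex_Ici 0) (continuousOn_id.mul hc)
    intro z hz
    rw [interior_Ici] at hz
    have h := (hasDerivAt_id z).mul (hd z hz)
    have h2 : deriv (fun z => z * g.f z r) z = 1 * g.f z r + z * g.fz z r := h.deriv
    change 0 < deriv (fun z => z * g.f z r) z
    rw [h2, one_mul]
    exact g.contest z r (le_of_lt hz) hr

/-- One component of the planar map. -/
def PP (f : ℝ → ℝ) (c d a b : ℝ) : ℝ := a * f (c * a + d * b)

section
variable {f : ℝ → ℝ} {r c d : ℝ}

theorem PP_nonneg (h : GoodG f r) (hc : 0 < c) (hd : 0 < d) {a b : ℝ} (ha : 0 ≤ a) (hb : 0 ≤ b) :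
    0 ≤ PP f c d a b :=
  mul_nonneg ha (h.pos _ (by positivity)).le

theorem PP_bound (h : GoodG f r) (hc : 0 < c) (hd : 0 < d) {a b M : ℝ} (ha : 0 ≤ a) (hb : 0 ≤ b)
    (hM : r / c ≤ M) (haM : a ≤ M) : PP f c d a b ≤ M := by
  unfold PP
  have hca : 0 ≤ c * a := by positivity
  have hle : c * a ≤ c * a + d * b := by nlinarith [mul_nonneg hd.le hb]
  rcases le_total (c * a) r with h1 | h1
  · have h2 : f (c * a + d * b) ≤ f (c * a) := h.anti.antitoneOn hca (hca.trans hle) hle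
    have h3 : c * a * f (c * a) ≤ r * f r := h.mono.monotoneOn hca h.rpos.le h1
    rw [h.unit, mul_one] at h3
    have h4 : a * f (c * a) ≤ r / c := by
      rw [le_div_iff₀ hc]; linarith
    have := mul_le_mul_of_nonneg_left h2 ha
    linarith
  · have h2 : f (c * a + d * b) ≤ f r :=
      h.anti.antitoneOn h.rpos.le (hca.trans hle) (h1.trans hle)
    rw [h.unit] at h2
    nlinarith

/-- Key expansion lemma. -/
theorem PP_key (h : GoodG f r) (hc : 0 < c) (hd : 0 < d) {a b a' b' : ℝ} (ha : 0 < a) (hb : 0 ≤ b)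
    (hb' : 0 ≤ b') (haa : a < a') (hx : b' * a ≤ a' * b) : PP f c d a b < PP f c d a' b' := by
  unfold PP
  obtain ⟨t, ht⟩ : ∃ t, t = a' / a := ⟨_, rfl⟩
  have hta : a' = t * a := by rw [ht]; field_simp
  have ht1 : 1 < t := by rw [ht, lt_div_iff₀ ha]; linarith
  have hbt : b' ≤ t * b := by
    rw [hta] at hx
    have : b' * a ≤ (t * b) * a := by linarith
    exact le_of_mul_le_mul_right this ha
  have hz : 0 < c * a + d * b := by positivity
  have ha' : 0 < a' := ha.trans haa
  have hz' : 0 ≤ c * a' + d * b' := by positivity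
  have hle : c * a' + d * b' ≤ t * (c * a + d * b) := by
    rw [hta]; nlinarith [mul_le_mul_of_nonneg_left hbt hd.le]
  have h1 : f (t * (c * a + d * b)) ≤ f (c * a' + d * b') :=
    h.anti.antitoneOn hz' (hz'.trans hle) hle
  have h2 : (c * a + d * b) * f (c * a + d * b)
      < (t * (c * a + d * b)) * f (t * (c * a + d * b)) :=
    h.mono hz.le (hz'.trans hle) (by nlinarith)
  have h3 : f (c * a + d * b) < t * f (t * (c * a + d * b)) := by
    refine lt_of_mul_lt_mul_left ?_ hz.le
    linarith
  calc a * f (c * a + d * b) < a * (t * f (t * (c * a + d * b))) := mul_lt_mul_of_pos_left h3 ha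
    _ = a' * f (t * (c * a + d * b)) := by rw [hta]; ring
    _ ≤ a' * f (c * a' + d * b') := mul_le_mul_of_nonneg_left h1 ha'.le

/-- Monotonicity in the south-east order. -/
theorem PP_mono (h : GoodG f r) (hc : 0 < c) (hd : 0 < d) {a b a' b' : ℝ} (ha : 0 ≤ a)
    (hb' : 0 ≤ b') (haa : a ≤ a') (hbb : b' ≤ b) : PP f c d a b ≤ PP f c d a' b' := by
  have hb := hb'.trans hbb
  have ha' := ha.trans haa
  rcases ha.eq_or_lt with h0 | h0
  · rw [← h0]
    simpa [PP] using PP_nonneg h hc hd ha' hb'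
  rcases haa.eq_or_lt with h1 | h1
  · subst h1
    unfold PP
    refine mul_le_mul_of_nonneg_left ?_ ha
    have : d * b' ≤ d * b := mul_le_mul_of_nonneg_left hbb hd.le
    exact h.anti.antitoneOn (Set.mem_Ici.2 (by positivity)) (Set.mem_Ici.2 (by positivity))
      (by linarith)
  · refine (PP_key h hc hd h0 hb hb' h1 ?_).le
    nlinarith

theorem PP_tendsto (h : GoodG f r) (hc : 0 < c) (hd : 0 < d) {u v : ℕ → ℝ} {a b : ℝ}
    (hu0 : ∀ k, 0 ≤ u k) (hv0 : ∀ k, 0 ≤ v k)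
    (hu : Tendsto u atTop (𝓝 a)) (hv : Tendsto v atTop (𝓝 b)) :
    Tendsto (fun k => PP f c d (u k) (v k)) atTop (𝓝 (PP f c d a b)) := by
  have ha : 0 ≤ a := ge_of_tendsto' hu hu0
  have hb : 0 ≤ b := ge_of_tendsto' hv hv0
  unfold PP
  refine hu.mul ?_
  have hz : 0 ≤ c * a + d * b := by positivity
  refine (h.cont _ hz).tendsto.comp (tendsto_nhdsWithin_iff.2 ⟨?_, ?_⟩)
  · exact (hu.const_mul c).add (hv.const_mul d)
  · refine Eventually.of_forall fun k => ?_
    have := hu0 k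
    have := hv0 k
    exact Set.mem_Ici.2 (by positivity)
end

theorem tendsto_of_mono_from {u : ℕ → ℝ} {M : ℝ} (k : ℕ) (h : ∀ j ≥ k, u j ≤ u (j + 1))
    (hM : ∀ j, u j ≤ M) : ∃ a, Tendsto u atTop (𝓝 a) := by
  have hm : Monotone (fun j => u (j + k)) :=
    monotone_nat_of_le_succ fun j => by
      have := h (j + k) (by omega)
      rwa [show j + k + 1 = j + 1 + k by omega] at this
  have hb : BddAbove (Set.range (fun j => u (j + k))) := ⟨M, by rintro _ ⟨j, rfl⟩; exact hM _⟩
  exact ⟨_, (tendsto_add_atTop_iff_nat k).1 (tendsto_atTop_ciSup hm hb)⟩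

theorem tendsto_of_anti_from {u : ℕ → ℝ} (k : ℕ) (h : ∀ j ≥ k, u (j + 1) ≤ u j)
    (hM : ∀ j, 0 ≤ u j) : ∃ a, Tendsto u atTop (𝓝 a) := by
  obtain ⟨a, ha⟩ := tendsto_of_mono_from (u := fun j => - u j) (M := 0) k
    (fun j hj => neg_le_neg (h j hj)) (fun j => by have := hM j; linarith)
  exact ⟨-a, by simpa using ha.neg⟩

theorem planar {f g : ℝ → ℝ} {r s c d c' d' : ℝ} (hf : GoodG f r) (hg : GoodG g s)
    (hc : 0 < c) (hd : 0 < d) (hc' : 0 < c') (hd' : 0 < d') (u v : ℕ → ℝ)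
    (hu0 : 0 ≤ u 0) (hv0 : 0 ≤ v 0)
    (hu : ∀ k, u (k + 1) = PP f c d (u k) (v k))
    (hv : ∀ k, v (k + 1) = PP g c' d' (v k) (u k)) :
    ∃ a b, Tendsto u atTop (𝓝 a) ∧ Tendsto v atTop (𝓝 b) ∧
      PP f c d a b = a ∧ PP g c' d' b a = b := by
  have hn : ∀ k, 0 ≤ u k ∧ 0 ≤ v k := by
    intro k
    induction k with
    | zero => exact ⟨hu0, hv0⟩
    | succ k ih =>
      rw [hu, hv]
      exact ⟨PP_nonneg hf hc hd ih.1 ih.2, PP_nonneg hg hc' hd' ih.2 ih.1⟩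
  have hun := fun k => (hn k).1
  have hvn := fun k => (hn k).2
  have hub : ∀ k, u k ≤ max (u 0) (r / c) := by
    intro k
    induction k with
    | zero => exact le_max_left _ _
    | succ k ih => rw [hu]; exact PP_bound hf hc hd (hun k) (hvn k) (le_max_right _ _) ih
  have hvb : ∀ k, v k ≤ max (v 0) (s / c') := by
    intro k
    induction k with
    | zero => exact le_max_left _ _
    | succ k ih => rw [hv]; exact PP_bound hg hc' hd' (hvn k) (hun k) (le_max_right _ _) ih
  suffices hconv : (∃ a, Tendsto u atTop (𝓝 a)) ∧ (∃ b, Tendsto v atTop (𝓝 b)) by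
    obtain ⟨⟨a, ha⟩, ⟨b, hb⟩⟩ := hconv
    refine ⟨a, b, ha, hb, ?_, ?_⟩
    · refine tendsto_nhds_unique (PP_tendsto hf hc hd hun hvn ha hb) ?_
      simp only [← hu]
      exact (tendsto_add_atTop_iff_nat 1).2 ha
    · refine tendsto_nhds_unique (PP_tendsto hg hc' hd' hvn hun hb ha) ?_
      simp only [← hv]
      exact (tendsto_add_atTop_iff_nat 1).2 hb
  by_cases hB : ∃ k, u k ≤ u (k + 1) ∧ v (k + 1) ≤ v k
  · obtain ⟨k, hk⟩ := hB
    have hall : ∀ j ≥ k, u j ≤ u (j + 1) ∧ v (j + 1) ≤ v j := by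
      intro j hj
      induction j, hj using Nat.le_induction with
      | base => exact hk
      | succ j hj ih =>
        have m1 := PP_mono hf hc hd (hun j) (hvn _) ih.1 ih.2
        have m2 := PP_mono hg hc' hd' (hvn _) (hun j) ih.2 ih.1
        rw [← hu, ← hu] at m1
        rw [← hv, ← hv] at m2
        exact ⟨m1, m2⟩
    exact ⟨tendsto_of_mono_from k (fun j hj => (hall j hj).1) hub,
      tendsto_of_anti_from k (fun j hj => (hall j hj).2) hvn⟩
  by_cases hC : ∃ k, u (k + 1) ≤ u k ∧ v k ≤ v (k + 1)
  · obtain ⟨k, hk⟩ := hC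
    have hall : ∀ j ≥ k, u (j + 1) ≤ u j ∧ v j ≤ v (j + 1) := by
      intro j hj
      induction j, hj using Nat.le_induction with
      | base => exact hk
      | succ j hj ih =>
        have m1 := PP_mono hf hc hd (hun _) (hvn j) ih.1 ih.2
        have m2 := PP_mono hg hc' hd' (hvn j) (hun _) ih.2 ih.1
        rw [← hu, ← hu] at m1
        rw [← hv, ← hv] at m2
        exact ⟨m1, m2⟩
    exact ⟨tendsto_of_anti_from k (fun j hj => (hall j hj).1) hun,
      tendsto_of_mono_from k (fun j hj => (hall j hj).2) hvb⟩
  push Not at hB hC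
  -- strict: both increase or both decrease
  by_cases hA : ∃ k, u k ≤ u (k + 1)
  · obtain ⟨k, hk⟩ := hA
    have hall : ∀ j ≥ k, u j ≤ u (j + 1) ∧ v j ≤ v (j + 1) := by
      intro j hj
      induction j, hj using Nat.le_induction with
      | base => exact ⟨hk, (hB k hk).le⟩
      | succ j hj ih =>
        by_contra hcon
        have hv1 := hB j ih.1
        have hu1 : u j < u (j + 1) := by
          by_contra hh
          exact absurd (hC j (not_lt.1 hh)) (not_lt.2 ih.2)
        have hu2 : u (j + 1 + 1) ≤ u (j + 1) := by
          by_contra hh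
          exact hcon ⟨(not_le.1 hh).le, (hB (j + 1) (not_le.1 hh).le).le⟩
        have hv2 := hC (j + 1) hu2
        have hup : 0 < u j := by
          rcases (hun j).eq_or_lt with h0 | h0
          · have := hu j
            rw [← h0] at this
            simp only [PP, zero_mul] at this
            linarith
          · exact h0
        have hvp : 0 < v j := by
          rcases (hvn j).eq_or_lt with h0 | h0
          · have := hv j
            rw [← h0] at this
            simp only [PP, zero_mul] at this
            linarith
          · exact h0
        rcases le_total (v (j + 1) * u j) (u (j + 1) * v j) with hx | hx
        · have := PP_key hf hc hd hup hvp.le (hvn _) hu1 hx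
          rw [← hu, ← hu] at this
          linarith
        · have := PP_key hg hc' hd' hvp hup.le (hun _) hv1 hx
          rw [← hv, ← hv] at this
          linarith
    exact ⟨tendsto_of_mono_from k (fun j hj => (hall j hj).1) hub,
      tendsto_of_mono_from k (fun j hj => (hall j hj).2) hvb⟩
  · push Not at hA
    exact ⟨tendsto_of_anti_from 0 (fun j _ => (hA j).le) hun,
      tendsto_of_anti_from 0 (fun j _ => (hC j (hA j).le).le) hvn⟩

/-- Every T ∈ DCS(2,f) has trivial dynamics: every orbit
starting in ℝ₊² converges to a fixed point of T. -/
theorem stmt9 (fam : Fin 2 → GrowthF) (r : Fin 2 → ℝ) (μ : Fin 2 → Fin 2 → ℝ)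
    (hr : ∀ i, 0 < r i) (hμ : ∀ i j, 0 < μ i j) :
    ∀ x ∈ orthant 2, ∃ y : Fin 2 → ℝ, DCS.map fam r μ y = y ∧
      Tendsto (fun k => (DCS.map fam r μ)^[k] x) atTop (𝓝 y) := by
  intro x hx
  have e0 : ∀ y : Fin 2 → ℝ, DCS.map fam r μ y 0
      = PP (fun z => (fam 0).f z (r 0)) (r 0 * μ 0 0) (r 0 * μ 0 1) (y 0) (y 1) := by
    intro y
    simp only [DCS.map, DCS.F, PP, Fin.sum_univ_two, mul_add, mul_assoc]
  have e1 : ∀ y : Fin 2 → ℝ, DCS.map fam r μ y 1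
      = PP (fun z => (fam 1).f z (r 1)) (r 1 * μ 1 1) (r 1 * μ 1 0) (y 1) (y 0) := by
    intro y
    simp only [DCS.map, DCS.F, PP, Fin.sum_univ_two, mul_add, mul_assoc]
    rw [add_comm]
  obtain ⟨a, b, ha, hb, hfa, hfb⟩ := planar ((fam 0).good (hr 0)) ((fam 1).good (hr 1))
    (mul_pos (hr 0) (hμ 0 0)) (mul_pos (hr 0) (hμ 0 1))
    (mul_pos (hr 1) (hμ 1 1)) (mul_pos (hr 1) (hμ 1 0))
    (fun k => (DCS.map fam r μ)^[k] x 0) (fun k => (DCS.map fam r μ)^[k] x 1)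
    (hx 0) (hx 1)
    (fun k => by simp only [Function.iterate_succ_apply']; exact e0 _)
    (fun k => by simp only [Function.iterate_succ_apply']; exact e1 _)
  refine ⟨![a, b], ?_, ?_⟩
  · funext i
    fin_cases i
    · exact (e0 _).trans hfa
    · exact (e1 _).trans hfb
  · rw [tendsto_pi_nhds]
    intro i
    fin_cases i
    · exact ha
    · exact hb
end

section
/- Let T ∈ DCS(2,f). Then q₍₁₎ = (1/μ₁₁, 0) is a fixed point of T, and the Jacobian DT(q₍₁₎) is upper triangular with eigenvalues λ₁ = 1 + r₁·∂f₁/∂z(r₁,r₁) ∈ (0,1) and λ₂ = f₂(r₂μ₂₁/μ₁₁, r₂). Moreover λ₂ > 1 if γ₁₂ > 0, λ₂ < 1 if γ₁₂ < 0, and λ₂ = 1 if γ₁₂ = 0; thus q₍₁₎ is a hyperbolic fixed point (no eigenvalue of modulus 1) if and only if γ₁₂ ≠ 0, it is a saddle when γ₁₂ > 0, and when γ₁₂ < 0 both eigenvalues lie in (0,1) so q₍₁₎ is asymptotically stable. -/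
open Set Filter Metric Topology Polynomial

/-- The axial fixed point q₍₁₎ = (1/μ₁₁, 0) of a planar map in DCS(2,f). -/
noncomputable def axq1 (μ : Fin 2 → Fin 2 → ℝ) : Fin 2 → ℝ := ![1 / μ 0 0, 0]

/-- λ₁ = 1 + r₁ ∂f₁/∂z(r₁,r₁). -/
noncomputable def lamOne (fam : Fin 2 → GrowthF) (r : Fin 2 → ℝ) : ℝ :=
  1 + r 0 * (fam 0).fz (r 0) (r 0)

/-- λ₂ = f₂(r₂ μ₂₁/μ₁₁, r₂), the external eigenvalue of DT(q₍₁₎). -/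
noncomputable def lamTwo (fam : Fin 2 → GrowthF) (r : Fin 2 → ℝ)
    (μ : Fin 2 → Fin 2 → ℝ) : ℝ :=
  (fam 1).f (r 1 * (μ 1 0 / μ 0 0)) (r 1)

theorem GrowthF.hasDerivAt_pos (g : GrowthF) {z r : ℝ} (hz : 0 < z) (hr : 0 < r) :
    HasDerivAt (fun w => g.f w r) (g.fz z r) z :=
  (g.hasDeriv z r hz.le hr).hasDerivAt (Ici_mem_nhds hz)

theorem GrowthF.strictAnti (g : GrowthF) {r : ℝ} (hr : 0 < r) :
    StrictAntiOn (fun w => g.f w r) (Set.Ici 0) := by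
  apply strictAntiOn_of_deriv_neg (convex_Ici 0)
  · intro z hz
    exact (g.hasDeriv z r hz hr).continuousWithinAt
  · intro z hz
    rw [interior_Ici] at hz
    rw [(g.hasDerivAt_pos hz hr).deriv]
    exact g.fz_neg z r (le_of_lt hz) hr

theorem contraction_aux (T : (Fin 2 → ℝ) → (Fin 2 → ℝ)) (q : Fin 2 → ℝ) (M ρ : ℝ)
    (hM : 1 ≤ M) (h0 : 0 ≤ ρ) (h1 : ρ < 1)
    (h : ∀ᶠ x in 𝓝 q, |T x 0 - q 0| + M * |T x 1 - q 1| ≤ ρ * (|x 0 - q 0| + M * |x 1 - q 1|)) :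
    ∃ δ > (0 : ℝ), ∀ x, dist x q < δ → ∀ k : ℕ,
      dist (T^[k] x) q ≤ ρ ^ k * ((1 + M) * dist x q) := by
  obtain ⟨d, hd, hball⟩ := Metric.eventually_nhds_iff.1 h
  have hlow : ∀ x : Fin 2 → ℝ, dist x q ≤ |x 0 - q 0| + M * |x 1 - q 1| := by
    intro x
    have e0 := abs_nonneg (x 0 - q 0)
    have e1 := abs_nonneg (x 1 - q 1)
    rw [dist_pi_le_iff (by positivity)]
    intro i
    rw [Real.dist_eq]
    fin_cases i <;> simp <;> nlinarith
  have hup : ∀ x : Fin 2 → ℝ, |x 0 - q 0| + M * |x 1 - q 1| ≤ (1 + M) * dist x q := by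
    intro x
    have e0 := dist_le_pi_dist x q 0
    have e1 := dist_le_pi_dist x q 1
    rw [Real.dist_eq] at e0 e1
    nlinarith
  refine ⟨d / (1 + M), by positivity, ?_⟩
  intro x hx k
  rw [lt_div_iff₀ (by positivity)] at hx
  have key : ∀ k : ℕ, |(T^[k] x) 0 - q 0| + M * |(T^[k] x) 1 - q 1| ≤
      ρ ^ k * ((1 + M) * dist x q) := by
    intro k
    induction k with
    | zero => simpa using hup x
    | succ k ih =>
      have hp : ρ ^ k ≤ 1 := pow_le_one₀ h0 h1.le
      have hnn : 0 ≤ (1 + M) * dist x q := by positivity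
      have hlt : dist (T^[k] x) q < d := by
        have := hlow (T^[k] x)
        nlinarith
      have := hball hlt
      rw [Function.iterate_succ_apply', pow_succ]
      have h3 := mul_le_mul_of_nonneg_left ih h0
      linarith
  exact (hlow _).trans (key k)

theorem stable_aux (T : (Fin 2 → ℝ) → (Fin 2 → ℝ)) (q : Fin 2 → ℝ) (M ρ : ℝ)
    (hM : 1 ≤ M) (h0 : 0 ≤ ρ) (h1 : ρ < 1)
    (h : ∀ᶠ x in 𝓝 q, |T x 0 - q 0| + M * |T x 1 - q 1| ≤ ρ * (|x 0 - q 0| + M * |x 1 - q 1|)) :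
    (∀ ε > (0 : ℝ), ∃ δ > (0 : ℝ), ∀ x ∈ orthant 2, dist x q < δ →
        ∀ k : ℕ, dist (T^[k] x) q < ε) ∧
      (∃ δ > (0 : ℝ), ∀ x ∈ orthant 2, dist x q < δ →
        Tendsto (fun k => T^[k] x) atTop (𝓝 q)) := by
  obtain ⟨d, hd, H⟩ := contraction_aux T q M ρ hM h0 h1 h
  constructor
  · intro ε hε
    refine ⟨min d (ε / (1 + M)), by positivity, ?_⟩
    intro x _ hx k
    have hx1 := lt_of_lt_of_le hx (min_le_left _ _)
    have hx2 := lt_of_lt_of_le hx (min_le_right _ _)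
    rw [lt_div_iff₀ (by positivity)] at hx2
    have hp : ρ ^ k ≤ 1 := pow_le_one₀ h0 h1.le
    have hnn : 0 ≤ (1 + M) * dist x q := by positivity
    have := H x hx1 k
    nlinarith
  · refine ⟨d, hd, ?_⟩
    intro x _ hx
    rw [tendsto_iff_dist_tendsto_zero]
    refine squeeze_zero (fun _ => dist_nonneg) (H x hx) ?_
    have := (tendsto_pow_atTop_nhds_zero_of_lt_one h0 h1).mul_const ((1 + M) * dist x q)
    simpa using this

theorem contr_aux (fam : Fin 2 → GrowthF) (r : Fin 2 → ℝ) (μ : Fin 2 → Fin 2 → ℝ)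
    (hr : ∀ i, 0 < r i) (hμ : ∀ i j, 0 < μ i j)
    (hl1 : 0 < lamOne fam r ∧ lamOne fam r < 1)
    (hl2 : 0 < lamTwo fam r μ ∧ lamTwo fam r μ < 1) :
    ∃ M ρ : ℝ, 1 ≤ M ∧ 0 ≤ ρ ∧ ρ < 1 ∧
      ∀ᶠ x in 𝓝 (axq1 μ), |DCS.map fam r μ x 0 - axq1 μ 0| + M * |DCS.map fam r μ x 1 - axq1 μ 1|
        ≤ ρ * (|x 0 - axq1 μ 0| + M * |x 1 - axq1 μ 1|) := by
  have m00 := hμ 0 0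
  have m10 := hμ 1 0
  have r0 := hr 0
  have r1 := hr 1
  have q0 : axq1 μ 0 = 1 / μ 0 0 := by simp [axq1]
  have q1 : axq1 μ 1 = 0 := by simp [axq1]
  obtain ⟨lam, hlam1, hlam2⟩ : ∃ l, max (lamOne fam r) (lamTwo fam r μ) < l ∧ l < 1 :=
    exists_between (max_lt hl1.2 hl2.2)
  obtain ⟨ρ, hρ1, hρ2⟩ := exists_between hlam2
  have hlamA := (le_max_left _ _).trans_lt hlam1
  have hlamB := (le_max_right _ _).trans_lt hlam1
  set c := (fam 0).fz (r 0) (r 0) with hc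
  set B := |1 / μ 0 0 * c * r 0 * μ 0 1| + 1 with hB
  have hBpos : 0 < B := by positivity
  set s : ℝ → ℝ := dslope (fun w => (fam 0).f w (r 0)) (r 0) with hs
  have hder := (fam 0).hasDerivAt_pos r0 r0
  have hsr : s (r 0) = c := by rw [hs, dslope_same, hder.deriv]
  have hscont : ContinuousAt s (r 0) := continuousAt_dslope_same.2 hder.differentiableAt
  have hsmul : ∀ z, (fam 0).f z (r 0) - 1 = (z - r 0) * s z := by
    intro z
    have := sub_smul_dslope (fun w => (fam 0).f w (r 0)) (r 0) z
    simp only [smul_eq_mul] at this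
    rw [hs, this, (fam 0).unit _ r0]
  -- the two arguments
  have hz0 : r 0 * (μ 0 0 * axq1 μ 0 + μ 0 1 * axq1 μ 1) = r 0 := by
    rw [q0, q1]; field_simp; simp
  have hz1 : r 1 * (μ 1 0 * axq1 μ 0 + μ 1 1 * axq1 μ 1) = r 1 * (μ 1 0 / μ 0 0) := by
    rw [q0, q1]; ring
  have cS : ContinuousAt (fun x : Fin 2 → ℝ => s (r 0 * (μ 0 0 * x 0 + μ 0 1 * x 1))) (axq1 μ) := by
    refine ContinuousAt.comp (g := s) (by rw [hz0]; exact hscont) (by fun_prop)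
  have cF : ContinuousAt (fun x : Fin 2 → ℝ =>
      (fam 1).f (r 1 * (μ 1 0 * x 0 + μ 1 1 * x 1)) (r 1)) (axq1 μ) := by
    refine ContinuousAt.comp (g := fun w => (fam 1).f w (r 1)) ?_ (by fun_prop)
    rw [hz1]
    exact ((fam 1).hasDerivAt_pos (by positivity) r1).continuousAt
  have cA : ContinuousAt (fun x : Fin 2 → ℝ =>
      |1 + x 0 * s (r 0 * (μ 0 0 * x 0 + μ 0 1 * x 1)) * r 0 * μ 0 0|) (axq1 μ) := by
    exact (continuousAt_const.add
      ((((continuous_apply 0).continuousAt.mul cS).mul_const (r 0)).mul_const (μ 0 0))).abs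
  have cC : ContinuousAt (fun x : Fin 2 → ℝ =>
      |x 0 * s (r 0 * (μ 0 0 * x 0 + μ 0 1 * x 1)) * r 0 * μ 0 1|) (axq1 μ) := by
    exact ((((continuous_apply 0).continuousAt.mul cS).mul_const (r 0)).mul_const (μ 0 1)).abs
  have eA := cA.eventually_lt (continuousAt_const (y := lam)) (by
    rw [hz0, hsr, q0]
    have : 1 + 1 / μ 0 0 * c * r 0 * μ 0 0 = lamOne fam r := by
      rw [lamOne, ← hc]; field_simp
    rw [this, abs_of_pos hl1.1]; exact hlamA)
  have eC := cC.eventually_lt (continuousAt_const (y := B)) (by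
    rw [hz0, hsr, q0]
    rw [hB]; linarith)
  have eF := cF.abs.eventually_lt (continuousAt_const (y := lam)) (by
    simp only [hz1]
    change |lamTwo fam r μ| < lam
    rw [abs_of_pos hl2.1]; exact hlamB)
  have hlpos : 0 < lam := hl1.1.trans hlamA
  refine ⟨max 1 (B / (ρ - lam)), ρ, le_max_left _ _, (hlpos.trans hρ1).le, hρ2, ?_⟩
  have hMB : B ≤ max 1 (B / (ρ - lam)) * (ρ - lam) := by
    rw [← div_le_iff₀ (by linarith)]; exact le_max_right _ _
  have hM1 : 1 ≤ max 1 (B / (ρ - lam)) := le_max_left _ _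
  generalize max 1 (B / (ρ - lam)) = M at hMB hM1 ⊢
  filter_upwards [eA, eC, eF] with x hA hC hF
  have hT1 : DCS.map fam r μ x 1 - axq1 μ 1 =
      x 1 * (fam 1).f (r 1 * (μ 1 0 * x 0 + μ 1 1 * x 1)) (r 1) := by
    simp [DCS.map, DCS.F, Fin.sum_univ_two, q1]
  have hT0 : DCS.map fam r μ x 0 - axq1 μ 0 =
      (x 0 - axq1 μ 0) * (1 + x 0 * s (r 0 * (μ 0 0 * x 0 + μ 0 1 * x 1)) * r 0 * μ 0 0) +
      x 1 * (x 0 * s (r 0 * (μ 0 0 * x 0 + μ 0 1 * x 1)) * r 0 * μ 0 1) := by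
    simp only [DCS.map, DCS.F, Fin.sum_univ_two]
    have := hsmul (r 0 * (μ 0 0 * x 0 + μ 0 1 * x 1))
    rw [sub_eq_iff_eq_add] at this
    rw [this, q0]
    field_simp
    ring
  have h0 : |DCS.map fam r μ x 0 - axq1 μ 0| ≤ |x 0 - axq1 μ 0| * lam + |x 1| * B := by
    rw [hT0]
    refine (abs_add_le _ _).trans ?_
    rw [abs_mul, abs_mul (x 1)]
    gcongr
  have h1 : |DCS.map fam r μ x 1 - axq1 μ 1| ≤ |x 1| * lam := by
    rw [hT1, abs_mul]
    gcongr
  have e : x 1 - axq1 μ 1 = x 1 := by rw [q1, sub_zero]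
  rw [e]
  have p0 := abs_nonneg (x 0 - axq1 μ 0)
  have p1 := abs_nonneg (x 1)
  have k1 := mul_le_mul_of_nonneg_left h1 (by linarith : 0 ≤ M)
  have k2 := mul_le_mul_of_nonneg_left hMB p1
  have k3 := mul_le_mul_of_nonneg_left hρ1.le p0
  linarith

/-- For T ∈ DCS(2,f), q₍₁₎ = (1/μ₁₁,0) is a fixed point; the
Jacobian DT(q₍₁₎) is upper triangular with eigenvalues λ₁ ∈ (0,1) and
λ₂ = f₂(r₂μ₂₁/μ₁₁, r₂); λ₂ > 1, < 1, = 1 according to the sign of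
γ₁₂ = μ₁₁ − μ₂₁; q₍₁₎ is hyperbolic iff γ₁₂ ≠ 0; and when γ₁₂ < 0 both
eigenvalues lie in (0,1) and q₍₁₎ is asymptotically stable. -/
theorem stmt10 (fam : Fin 2 → GrowthF) (r : Fin 2 → ℝ) (μ : Fin 2 → Fin 2 → ℝ)
    (hr : ∀ i, 0 < r i) (hμ : ∀ i j, 0 < μ i j) :
    DCS.map fam r μ (axq1 μ) = axq1 μ ∧
    DCS.jac fam r μ (axq1 μ) 1 0 = 0 ∧
    DCS.jac fam r μ (axq1 μ) 0 0 = lamOne fam r ∧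
    (0 < lamOne fam r ∧ lamOne fam r < 1) ∧
    DCS.jac fam r μ (axq1 μ) 1 1 = lamTwo fam r μ ∧
    ((0 < μ 0 0 - μ 1 0 → 1 < lamTwo fam r μ) ∧
     (μ 0 0 - μ 1 0 < 0 → lamTwo fam r μ < 1) ∧
     (μ 0 0 - μ 1 0 = 0 → lamTwo fam r μ = 1)) ∧
    ((|lamOne fam r| ≠ 1 ∧ |lamTwo fam r μ| ≠ 1) ↔ μ 0 0 - μ 1 0 ≠ 0) ∧
    (μ 0 0 - μ 1 0 < 0 →
      (0 < lamTwo fam r μ ∧ lamTwo fam r μ < 1) ∧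
      (∀ ε > (0 : ℝ), ∃ δ > (0 : ℝ), ∀ x ∈ orthant 2, dist x (axq1 μ) < δ →
        ∀ k : ℕ, dist ((DCS.map fam r μ)^[k] x) (axq1 μ) < ε) ∧
      (∃ δ > (0 : ℝ), ∀ x ∈ orthant 2, dist x (axq1 μ) < δ →
        Tendsto (fun k => (DCS.map fam r μ)^[k] x) atTop (𝓝 (axq1 μ)))) := by
  have m00 := hμ 0 0
  have m10 := hμ 1 0
  have r0 := hr 0
  have r1 := hr 1
  have hz0 : r 0 * (∑ j, μ 0 j * axq1 μ j) = r 0 := by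
    simp [axq1, Fin.sum_univ_two, m00.ne']
  have hz1 : r 1 * (∑ j, μ 1 j * axq1 μ j) = r 1 * (μ 1 0 / μ 0 0) := by
    simp [axq1, Fin.sum_univ_two, div_eq_mul_inv]
  have hF0 : DCS.F fam r μ 0 (axq1 μ) = 1 := by
    rw [DCS.F, hz0, (fam 0).unit _ r0]
  have hF1 : DCS.F fam r μ 1 (axq1 μ) = lamTwo fam r μ := by
    rw [DCS.F, hz1, lamTwo]
  have q0 : axq1 μ 0 = 1 / μ 0 0 := by simp [axq1]
  have q1 : axq1 μ 1 = 0 := by simp [axq1]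
  have hl1 : 0 < lamOne fam r ∧ lamOne fam r < 1 := by
    have a := (fam 0).contest (r 0) (r 0) r0.le r0
    rw [(fam 0).unit _ r0] at a
    have b := mul_neg_of_pos_of_neg r0 ((fam 0).fz_neg (r 0) (r 0) r0.le r0)
    exact ⟨a, by rw [lamOne]; linarith⟩
  have hw : 0 ≤ r 1 * (μ 1 0 / μ 0 0) := by positivity
  have hpos : 0 < lamTwo fam r μ := (fam 1).pos _ _ hw r1
  have hu := (fam 1).unit _ r1
  have hgt : 0 < μ 0 0 - μ 1 0 → 1 < lamTwo fam r μ := by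
    intro h
    have h2 : μ 1 0 / μ 0 0 < 1 := by rw [div_lt_one m00]; linarith
    have := (fam 1).strictAnti r1 hw r1.le (by nlinarith : r 1 * (μ 1 0 / μ 0 0) < r 1)
    simp only [hu] at this
    exact this
  have hlt : μ 0 0 - μ 1 0 < 0 → lamTwo fam r μ < 1 := by
    intro h
    have h2 : 1 < μ 1 0 / μ 0 0 := by rw [one_lt_div m00]; linarith
    have := (fam 1).strictAnti r1 r1.le hw (by nlinarith : r 1 < r 1 * (μ 1 0 / μ 0 0))
    simp only [hu] at this
    exact this
  have heq : μ 0 0 - μ 1 0 = 0 → lamTwo fam r μ = 1 := by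
    intro h
    have h2 : μ 1 0 / μ 0 0 = 1 := by rw [div_eq_one_iff_eq m00.ne']; linarith
    rw [lamTwo, h2, mul_one, hu]
  refine ⟨?_, ?_, ?_, hl1, ?_, ⟨hgt, hlt, heq⟩, ?_, ?_⟩
  · ext i
    fin_cases i
    · change axq1 μ 0 * DCS.F fam r μ 0 (axq1 μ) = axq1 μ 0
      rw [hF0, mul_one]
    · change axq1 μ 1 * DCS.F fam r μ 1 (axq1 μ) = axq1 μ 1
      rw [q1, zero_mul]
  · simp [DCS.jac, q1]
  · simp only [DCS.jac, Matrix.of_apply, if_true, hz0, hF0, lamOne, q0]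
    field_simp
  · simp [DCS.jac, q1, hF1]
  · rw [abs_of_pos hl1.1, abs_of_pos hpos]
    constructor
    · rintro ⟨_, h⟩ h'
      exact h (heq h')
    · intro h
      refine ⟨hl1.2.ne, ?_⟩
      rcases lt_or_gt_of_ne h with h | h
      · exact (hlt h).ne
      · exact (hgt h).ne'
  · intro h
    refine ⟨⟨hpos, hlt h⟩, ?_⟩
    obtain ⟨M, ρ, hM, h0, h1, H⟩ := contr_aux fam r μ hr hμ hl1 ⟨hpos, hlt h⟩
    exact stable_aux _ _ M ρ hM h0 h1 H
end

section
/- Let T ∈ DCS(2,f) with γ₁₂ > 0 and γ₂₁ > 0. Then T has a unique fixed point p in int ℝ₊², namely p = (γ₂₁/det U, γ₁₂/det U) where U = (μᵢⱼ); p is hyperbolic with both eigenvalues of DT(p) real and lying in (0,1); and for every x ∈ int ℝ₊², the orbit (Tᵏx)ₖ≥₀ converges to p. -/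
open Set Filter Metric Topology Polynomial

/-- Abstract one-species growth function with normalised equilibrium at `1`. -/
structure GoodH (h : ℝ → ℝ) : Prop where
  anti : StrictAntiOn h (Set.Ici 0)
  mono : MonotoneOn (fun w => w * h w) (Set.Ici 0)
  cont : ContinuousOn h (Set.Ici 0)
  pos : ∀ w, 0 ≤ w → 0 < h w
  one : h 1 = 1

lemma GoodH.of_growth (g : GrowthF) (r : ℝ) (hr : 0 < r) :
    GoodH (fun w => g.f (r * w) r) := by
  have hd : ∀ z, 0 < z → HasDerivAt (fun w => g.f w r) (g.fz z r) z := fun z hz =>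
    (g.hasDeriv z r hz.le hr).hasDerivAt (Ici_mem_nhds hz)
  have hc : ContinuousOn (fun w => g.f w r) (Set.Ici 0) := fun z hz =>
    (g.hasDeriv z r hz hr).continuousWithinAt
  have ha : StrictAntiOn (fun w => g.f w r) (Set.Ici 0) := by
    refine strictAntiOn_of_deriv_neg (convex_Ici 0) hc ?_
    intro z hz
    rw [interior_Ici] at hz
    rw [(hd z hz).deriv]
    exact g.fz_neg z r (le_of_lt hz) hr
  have hm : StrictMonoOn (fun w => w * g.f w r) (Set.Ici 0) := by
    refine strictMonoOn_of_deriv_pos (convex_Ici 0) (continuousOn_id.mul hc) ?_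
    intro z hz
    rw [interior_Ici] at hz
    have h := (hasDerivAt_id z).mul (hd z hz)
    have h' : HasDerivAt (fun w => w * g.f w r) (1 * g.f z r + z * g.fz z r) z := h
    rw [h'.deriv]
    have := g.contest z r (le_of_lt hz) hr
    linarith
  have hmem : ∀ w, w ∈ Set.Ici (0:ℝ) → r * w ∈ Set.Ici (0:ℝ) := fun w hw =>
    mul_nonneg hr.le hw
  refine ⟨?_, ?_, ?_, ?_, ?_⟩
  · intro x hx y hy hxy
    exact ha (hmem x hx) (hmem y hy) (mul_lt_mul_of_pos_left hxy hr)
  · intro x hx y hy hxy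
    have := hm.monotoneOn (hmem x hx) (hmem y hy) (mul_le_mul_of_nonneg_left hxy hr.le)
    simp only [mul_assoc] at this
    exact le_of_mul_le_mul_left this hr
  · exact hc.comp (by fun_prop) hmem
  · intro w hw
    exact g.pos _ _ (hmem w hw) hr
  · simpa using g.unit r hr

lemma GoodH.step {h : ℝ → ℝ} (H : GoodH h) {a b x y x' y' : ℝ} (ha : 0 < a) (hb : 0 < b)
    (hx : 0 < x) (hxx : x ≤ x') (hy : 0 < y') (hyy : y' ≤ y) :
    x * h (a * x + b * y) ≤ x' * h (a * x' + b * y') := by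
  have hw : 0 < a * x + b * y' := by positivity
  have hww : a * x + b * y' ≤ a * x' + b * y' := by gcongr
  have hw' : 0 < a * x' + b * y' := lt_of_lt_of_le hw hww
  have hw2 : a * x + b * y' ≤ a * x + b * y := by gcongr
  have h1 : h (a * x + b * y) ≤ h (a * x + b * y') :=
    H.anti.antitoneOn hw.le (hw.le.trans hw2) hw2
  have h2 := H.mono hw.le hw'.le hww
  simp only at h2
  have hp := H.pos _ hw'.le
  have h3 : x * (a * x' + b * y') ≤ x' * (a * x + b * y') := by
    nlinarith [mul_le_mul_of_nonneg_right hxx (mul_pos hb hy).le]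
  refine (mul_le_mul_of_nonneg_left h1 hx.le).trans ?_
  refine le_of_mul_le_mul_left ?_ hw
  nlinarith [mul_le_mul_of_nonneg_left h2 hx.le, mul_le_mul_of_nonneg_right h3 hp.le]

lemma GoodH.eq_one {h : ℝ → ℝ} (H : GoodH h) {w : ℝ} (hw : 0 ≤ w) (e : h w = 1) : w = 1 :=
  H.anti.injOn hw (zero_le_one' ℝ) (e.trans H.one.symm)

/-- The planar system with its two growth functions and coefficients. -/
structure Sys (h1 h2 : ℝ → ℝ) (a b c d p q : ℝ) : Prop where
  H1 : GoodH h1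
  H2 : GoodH h2
  ha : 0 < a
  hb : 0 < b
  hc : 0 < c
  hd : 0 < d
  hac : c < a
  hbd : b < d
  hp : 0 < p
  hq : 0 < q
  e1 : a * p + b * q = 1
  e2 : c * p + d * q = 1

lemma Sys.swap {h1 h2 : ℝ → ℝ} {a b c d p q : ℝ} (S : Sys h1 h2 a b c d p q) :
    Sys h2 h1 d c b a q p :=
  ⟨S.H2, S.H1, S.hd, S.hc, S.hb, S.ha, S.hbd, S.hac, S.hq, S.hp,
    by linarith [S.e2], by linarith [S.e1]⟩

lemma Sys.uniq {h1 h2 : ℝ → ℝ} {a b c d p q : ℝ} (S : Sys h1 h2 a b c d p q) {x y : ℝ}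
    (hx : 0 < x) (hy : 0 < y) (e1 : x * h1 (a * x + b * y) = x)
    (e2 : y * h2 (c * x + d * y) = y) : x = p ∧ y = q := by
  have ha := S.ha
  have hb := S.hb
  have hc := S.hc
  have hd := S.hd
  have u : a * x + b * y = 1 := S.H1.eq_one (by positivity) (by
    have := mul_left_cancel₀ hx.ne' (e1.trans (mul_one x).symm); exact this)
  have v : c * x + d * y = 1 := S.H2.eq_one (by positivity) (by
    have := mul_left_cancel₀ hy.ne' (e2.trans (mul_one y).symm); exact this)
  have f1 := S.e1
  have f2 := S.e2
  have hdet : 0 < a * d - b * c := by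
    nlinarith [mul_lt_mul'' S.hac S.hbd hc.le hb.le]
  constructor
  · refine mul_left_cancel₀ hdet.ne' ?_
    linear_combination d * u - b * v - d * f1 + b * f2
  · refine mul_left_cancel₀ hdet.ne' ?_
    linear_combination a * v - c * u - a * f2 + c * f1

/-- `(x k, y k)` is a positive orbit. -/
structure Orb (h1 h2 : ℝ → ℝ) (a b c d : ℝ) (x y : ℕ → ℝ) : Prop where
  hx : ∀ k, 0 < x k
  hy : ∀ k, 0 < y k
  ex : ∀ k, x (k + 1) = x k * h1 (a * x k + b * y k)
  ey : ∀ k, y (k + 1) = y k * h2 (c * x k + d * y k)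

lemma Orb.swap {h1 h2 : ℝ → ℝ} {a b c d : ℝ} {x y : ℕ → ℝ} (O : Orb h1 h2 a b c d x y) :
    Orb h2 h1 d c b a y x :=
  ⟨O.hy, O.hx, fun k => by rw [O.ey, add_comm], fun k => by rw [O.ex, add_comm]⟩

/-- Comparison of orbits in the south-east order. -/
lemma Sys.compare {h1 h2 : ℝ → ℝ} {a b c d p q : ℝ} (S : Sys h1 h2 a b c d p q)
    {x y x' y' : ℕ → ℝ} (O : Orb h1 h2 a b c d x y) (O' : Orb h1 h2 a b c d x' y')
    (h0 : x 0 ≤ x' 0) (h0' : y' 0 ≤ y 0) (k : ℕ) : x k ≤ x' k ∧ y' k ≤ y k := by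
  induction k with
  | zero => exact ⟨h0, h0'⟩
  | succ k ih =>
    constructor
    · rw [O.ex, O'.ex]
      exact S.H1.step S.ha S.hb (O.hx k) ih.1 (O'.hy k) ih.2
    · rw [O.ey, O'.ey, add_comm (c * x' k), add_comm (c * x k)]
      exact S.H2.step S.hd S.hc (O'.hy k) ih.2 (O.hx k) ih.1

lemma Sys.orb_const {h1 h2 : ℝ → ℝ} {a b c d p q : ℝ} (S : Sys h1 h2 a b c d p q) :
    Orb h1 h2 a b c d (fun _ => p) (fun _ => q) :=
  ⟨fun _ => S.hp, fun _ => S.hq, fun _ => by rw [S.e1, S.H1.one, mul_one],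
    fun _ => by rw [S.e2, S.H2.one, mul_one]⟩

lemma Orb.shift {h1 h2 : ℝ → ℝ} {a b c d : ℝ} {x y : ℕ → ℝ} (O : Orb h1 h2 a b c d x y)
    (m : ℕ) : Orb h1 h2 a b c d (fun k => x (k + m)) (fun k => y (k + m)) :=
  ⟨fun k => O.hx _, fun k => O.hy _,
    fun k => by rw [← O.ex, show k + 1 + m = k + m + 1 by omega],
    fun k => by rw [← O.ey, show k + 1 + m = k + m + 1 by omega]⟩

/-- Orbits starting in the north-west lower triangle converge to the equilibrium. -/
lemma Sys.nw {h1 h2 : ℝ → ℝ} {a b c d p q : ℝ} (S : Sys h1 h2 a b c d p q)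
    {x y : ℕ → ℝ} (O : Orb h1 h2 a b c d x y) (hxp : x 0 ≤ p) (hyq : q ≤ y 0)
    (hu : a * x 0 + b * y 0 ≤ 1) (hv : 1 ≤ c * x 0 + d * y 0) :
    Tendsto x atTop (𝓝 p) ∧ Tendsto y atTop (𝓝 q) := by
  have ha := S.ha
  have hb := S.hb
  have hc := S.hc
  have hd := S.hd
  have hx0 := O.hx 0
  have hy0 := O.hy 0
  have b1 := S.compare O S.orb_const hxp hyq
  have s0 : x 0 ≤ x 1 ∧ y 1 ≤ y 0 := by
    constructor
    · rw [O.ex]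
      have : h1 1 ≤ h1 (a * x 0 + b * y 0) :=
        S.H1.anti.antitoneOn (show (0:ℝ) ≤ _ by positivity) (zero_le_one' ℝ) hu
      rw [S.H1.one] at this
      nlinarith
    · rw [O.ey]
      have : h2 (c * x 0 + d * y 0) ≤ h2 1 :=
        S.H2.anti.antitoneOn (zero_le_one' ℝ) (show (0:ℝ) ≤ _ by positivity) hv
      rw [S.H2.one] at this
      nlinarith
  have b2 := S.compare O (O.shift 1) s0.1 s0.2
  have mx : Monotone x := monotone_nat_of_le_succ fun k => (b2 k).1
  have my : Antitone y := antitone_nat_of_succ_le fun k => (b2 k).2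
  have tx := tendsto_atTop_ciSup mx ⟨p, by rintro _ ⟨k, rfl⟩; exact (b1 k).1⟩
  have ty := tendsto_atTop_ciInf my ⟨q, by rintro _ ⟨k, rfl⟩; exact (b1 k).2⟩
  set l := ⨆ i, x i
  set m := ⨅ i, y i
  have hl : 0 < l := lt_of_lt_of_le hx0 (ge_of_tendsto' tx fun k => mx (Nat.zero_le k))
  have hm : 0 < m := lt_of_lt_of_le S.hq (ge_of_tendsto' ty fun k => (b1 k).2)
  have c1 : ContinuousAt h1 (a * l + b * m) :=
    S.H1.cont.continuousAt (Ici_mem_nhds (by positivity))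
  have c2 : ContinuousAt h2 (c * l + d * m) :=
    S.H2.cont.continuousAt (Ici_mem_nhds (by positivity))
  have t1 : Tendsto (fun k => x (k + 1)) atTop (𝓝 (l * h1 (a * l + b * m))) := by
    simp only [O.ex]
    exact tx.mul (c1.tendsto.comp ((tx.const_mul a).add (ty.const_mul b)))
  have t2 : Tendsto (fun k => y (k + 1)) atTop (𝓝 (m * h2 (c * l + d * m))) := by
    simp only [O.ey]
    exact ty.mul (c2.tendsto.comp ((tx.const_mul c).add (ty.const_mul d)))
  have e1 := tendsto_nhds_unique t1 (tx.comp (tendsto_add_atTop_nat 1))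
  have e2 := tendsto_nhds_unique t2 (ty.comp (tendsto_add_atTop_nat 1))
  obtain ⟨f1, f2⟩ := S.uniq hl hm e1 e2
  rw [f1] at tx
  rw [f2] at ty
  exact ⟨tx, ty⟩

/-- Eventually the second coordinate is below any level above its carrying capacity. -/
lemma Sys.absorb {h1 h2 : ℝ → ℝ} {a b c d p q : ℝ} (S : Sys h1 h2 a b c d p q)
    {x y : ℕ → ℝ} (O : Orb h1 h2 a b c d x y) {e : ℝ} (he : 1 < d * e) :
    ∃ N, ∀ k ≥ N, y k ≤ e := by
  have hc := S.hc
  have hd := S.hd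
  have hde : (0:ℝ) ≤ d * e := by linarith
  have he0 : 0 < e := by
    by_contra h
    nlinarith [mul_nonneg hd.le (not_lt.mp h |> sub_nonneg.mpr)]
  have hlt : h2 (d * e) < 1 := by
    have := S.H2.anti (zero_le_one' ℝ) hde he
    rwa [S.H2.one] at this
  have hpos := S.H2.pos _ hde
  have ex : ∃ N, y N ≤ e := by
    by_contra hcon
    push Not at hcon
    have key : ∀ k, y k ≤ y 0 * h2 (d * e) ^ k := by
      intro k
      induction k with
      | zero => simp
      | succ k ih =>
        have hx := O.hx k
        have hy := O.hy k
        rw [O.ey, pow_succ, ← mul_assoc]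
        have hle : d * e ≤ c * x k + d * y k := by
          nlinarith [mul_le_mul_of_nonneg_left (hcon k).le hd.le, mul_pos hc hx]
        have : h2 (c * x k + d * y k) ≤ h2 (d * e) :=
          S.H2.anti.antitoneOn hde (hde.trans hle) hle
        exact mul_le_mul ih this (S.H2.pos _ (hde.trans hle)).le
          (hy.le.trans ih)
    have t : Tendsto (fun k => y 0 * h2 (d * e) ^ k) atTop (𝓝 (y 0 * 0)) :=
      (tendsto_pow_atTop_nhds_zero_of_lt_one hpos.le hlt).const_mul _
    have := ge_of_tendsto' t fun k => (hcon k).le.trans (key k)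
    linarith
  obtain ⟨N, hN⟩ := ex
  refine ⟨N, fun k hk => ?_⟩
  induction k, hk using Nat.le_induction with
  | base => exact hN
  | succ k hk ih =>
    have hx := O.hx k
    have hy := O.hy k
    rw [O.ey, add_comm]
    refine (S.H2.step hd hc hy ih hx le_rfl).trans ?_
    have hle : d * e ≤ d * e + c * x k := by nlinarith [mul_pos hc hx]
    have : h2 (d * e + c * x k) ≤ h2 (d * e) :=
      S.H2.anti.antitoneOn hde (hde.trans hle) hle
    nlinarith

/-- One-sided barrier orbit: below (in the south-east order) and convergent. -/
lemma Sys.barrier {h1 h2 : ℝ → ℝ} {a b c d p q : ℝ} (S : Sys h1 h2 a b c d p q) :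
    ∃ e, 1 < d * e ∧ ∀ x0, 0 < x0 → ∃ x y : ℕ → ℝ, Orb h1 h2 a b c d x y ∧
      x 0 ≤ x0 ∧ y 0 = e ∧ Tendsto x atTop (𝓝 p) ∧ Tendsto y atTop (𝓝 q) := by
  have ha := S.ha
  have hb := S.hb
  have hc := S.hc
  have hd := S.hd
  have hinv : 1 / d < 1 / b := one_div_lt_one_div_of_lt hb S.hbd
  obtain ⟨e, he1, he2⟩ := exists_between hinv
  rw [div_lt_iff₀ hd] at he1
  rw [lt_div_iff₀ hb] at he2
  have he0 : 0 < e := by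
    by_contra h
    nlinarith [mul_nonneg hd.le (not_lt.mp h |> sub_nonneg.mpr)]
  refine ⟨e, by linarith, fun x0 hx0 => ?_⟩
  set s := min x0 (min p ((1 - b * e) / a)) with hs
  have hs0 : 0 < s := by
    refine lt_min hx0 (lt_min S.hp (div_pos (by linarith) ha))
  have hs1 : s ≤ x0 := min_le_left _ _
  have hs2 : s ≤ p := (min_le_right _ _).trans (min_le_left _ _)
  have hs3 : s ≤ (1 - b * e) / a := (min_le_right _ _).trans (min_le_right _ _)
  rw [le_div_iff₀ ha] at hs3
  let G : ℝ × ℝ → ℝ × ℝ := fun z =>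
    (z.1 * h1 (a * z.1 + b * z.2), z.2 * h2 (c * z.1 + d * z.2))
  have hpos : ∀ k, 0 < (G^[k] (s, e)).1 ∧ 0 < (G^[k] (s, e)).2 := by
    intro k
    induction k with
    | zero => exact ⟨hs0, he0⟩
    | succ k ih =>
      rw [Function.iterate_succ_apply']
      obtain ⟨i1, i2⟩ := ih
      exact ⟨mul_pos i1 (S.H1.pos _ (by positivity)), mul_pos i2 (S.H2.pos _ (by positivity))⟩
  have O : Orb h1 h2 a b c d (fun k => (G^[k] (s, e)).1) (fun k => (G^[k] (s, e)).2) :=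
    ⟨fun k => (hpos k).1, fun k => (hpos k).2,
      fun k => by simp only [Function.iterate_succ_apply']; rfl,
      fun k => by simp only [Function.iterate_succ_apply']; rfl⟩
  have hqe : q ≤ e := by
    refine le_of_mul_le_mul_left ?_ hd
    nlinarith [S.e2, mul_pos hc S.hp]
  obtain ⟨t1, t2⟩ := S.nw O hs2 hqe (by simp only [Function.iterate_zero, id]; linarith)
    (by simp only [Function.iterate_zero, id]; nlinarith [mul_pos hc hs0])
  exact ⟨_, _, O, hs1, rfl, t1, t2⟩

lemma Sys.converge {h1 h2 : ℝ → ℝ} {a b c d p q : ℝ} (S : Sys h1 h2 a b c d p q)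
    {x y : ℕ → ℝ} (O : Orb h1 h2 a b c d x y) :
    Tendsto x atTop (𝓝 p) ∧ Tendsto y atTop (𝓝 q) := by
  obtain ⟨e, he, B⟩ := S.barrier
  obtain ⟨e', he', B'⟩ := S.swap.barrier
  obtain ⟨N, hN⟩ := S.absorb O he
  obtain ⟨N', hN'⟩ := S.swap.absorb O.swap he'
  set m := max N N'
  have O2 := O.shift m
  obtain ⟨u, v, Ou, hu, hv, tu, tv⟩ := B (x m) (O.hx m)
  obtain ⟨v', u', Ou', hv', hu', tv', tu'⟩ := B' (y m) (O.hy m)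
  have hym := hN m (le_max_left _ _)
  have hxm := hN' m (le_max_right _ _)
  have c1 := S.compare Ou O2 (by simpa using hu) (by simpa [hv] using hym)
  have c2 := S.compare O2 Ou'.swap (by simpa [hu'] using hxm) (by simpa using hv')
  constructor
  · rw [← tendsto_add_atTop_iff_nat m]
    exact tendsto_of_tendsto_of_tendsto_of_le_of_le tu tu' (fun k => (c1 k).1) fun k => (c2 k).1
  · rw [← tendsto_add_atTop_iff_nat m]
    exact tendsto_of_tendsto_of_tendsto_of_le_of_le tv' tv (fun k => (c2 k).2) fun k => (c1 k).2

lemma quad_roots {A B K D : ℝ} (hA : 0 < A) (hA1 : A < 1) (hD : 0 < D) (hD1 : D < 1)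
    (hBK : 0 ≤ B * K) (h0 : B * K < A * D) (h1 : B * K < (1 - A) * (1 - D)) :
    ∃ u v : ℝ, 0 < u ∧ u < 1 ∧ 0 < v ∧ v < 1 ∧ u + v = A + D ∧ u * v = A * D - B * K := by
  have hnn : 0 ≤ (A - D) ^ 2 + 4 * (B * K) := by positivity
  set s := √((A - D) ^ 2 + 4 * (B * K)) with hs
  have hsq : s ^ 2 = (A - D) ^ 2 + 4 * (B * K) := Real.sq_sqrt hnn
  have hs0 : 0 ≤ s := Real.sqrt_nonneg _
  have k1 : s < A + D := by
    refine lt_of_pow_lt_pow_left₀ 2 (by linarith) ?_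
    nlinarith
  have k2 : s < 2 - A - D := by
    refine lt_of_pow_lt_pow_left₀ 2 (by linarith) ?_
    nlinarith
  exact ⟨(A + D - s) / 2, (A + D + s) / 2, by linarith, by linarith, by linarith, by linarith,
    by ring, by linear_combination (-1 / 4) * hsq⟩

/-- For T ∈ DCS(2,f) with γ₁₂ > 0 and γ₂₁ > 0: the point
p = (γ₂₁/det U, γ₁₂/det U) is the unique interior fixed point, it is
hyperbolic with both eigenvalues of DT(p) real and in (0,1), and every
interior orbit converges to p. -/
theorem stmt12 (fam : Fin 2 → GrowthF) (r : Fin 2 → ℝ) (μ : Fin 2 → Fin 2 → ℝ)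
    (hr : ∀ i, 0 < r i) (hμ : ∀ i j, 0 < μ i j)
    (hγ12 : 0 < μ 0 0 - μ 1 0) (hγ21 : 0 < μ 1 1 - μ 0 1)
    (p : Fin 2 → ℝ)
    (hpdef : p = ![(μ 1 1 - μ 0 1) / (μ 0 0 * μ 1 1 - μ 0 1 * μ 1 0),
                   (μ 0 0 - μ 1 0) / (μ 0 0 * μ 1 1 - μ 0 1 * μ 1 0)]) :
    p ∈ intOrthant 2 ∧ DCS.map fam r μ p = p ∧
    (∀ q ∈ intOrthant 2, DCS.map fam r μ q = q → q = p) ∧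
    (∃ a b : ℝ, 0 < a ∧ a < 1 ∧ 0 < b ∧ b < 1 ∧
      (DCS.jac fam r μ p).charpoly = (X - C a) * (X - C b)) ∧
    (∀ x ∈ intOrthant 2,
      Tendsto (fun k => (DCS.map fam r μ)^[k] x) atTop (𝓝 p)) := by
  have hdet : 0 < μ 0 0 * μ 1 1 - μ 0 1 * μ 1 0 := by
    nlinarith [mul_lt_mul'' (sub_pos.mp hγ12) (sub_pos.mp hγ21) (hμ 1 0).le (hμ 0 1).le]
  have hp0 : p 0 = (μ 1 1 - μ 0 1) / (μ 0 0 * μ 1 1 - μ 0 1 * μ 1 0) := by simp [hpdef]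
  have hp1 : p 1 = (μ 0 0 - μ 1 0) / (μ 0 0 * μ 1 1 - μ 0 1 * μ 1 0) := by simp [hpdef]
  have S : Sys (fun w => (fam 0).f (r 0 * w) (r 0)) (fun w => (fam 1).f (r 1 * w) (r 1))
      (μ 0 0) (μ 0 1) (μ 1 0) (μ 1 1) (p 0) (p 1) := by
    refine ⟨GoodH.of_growth _ _ (hr 0), GoodH.of_growth _ _ (hr 1), hμ 0 0, hμ 0 1, hμ 1 0,
      hμ 1 1, by linarith, by linarith, ?_, ?_, ?_, ?_⟩
    · rw [hp0]; exact div_pos hγ21 hdet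
    · rw [hp1]; exact div_pos hγ12 hdet
    · rw [hp0, hp1, mul_div_assoc', mul_div_assoc', ← add_div, div_eq_one_iff_eq hdet.ne']; ring
    · rw [hp0, hp1, mul_div_assoc', mul_div_assoc', ← add_div, div_eq_one_iff_eq hdet.ne']; ring
  clear hpdef hp0 hp1
  have m0 : ∀ x, DCS.map fam r μ x 0
      = x 0 * (fam 0).f (r 0 * (μ 0 0 * x 0 + μ 0 1 * x 1)) (r 0) := fun x => by
    simp [DCS.map, DCS.F, Fin.sum_univ_two]
  have m1 : ∀ x, DCS.map fam r μ x 1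
      = x 1 * (fam 1).f (r 1 * (μ 1 0 * x 0 + μ 1 1 * x 1)) (r 1) := fun x => by
    simp [DCS.map, DCS.F, Fin.sum_univ_two]
  have hpp := S.hp
  have hqq := S.hq
  refine ⟨?_, ?_, ?_, ?_, ?_⟩
  · intro i
    fin_cases i
    · exact S.hp
    · exact S.hq
  · funext i
    fin_cases i
    · change DCS.map fam r μ p 0 = p 0
      rw [m0]; exact (S.orb_const.ex 0).symm
    · change DCS.map fam r μ p 1 = p 1
      rw [m1]; exact (S.orb_const.ey 0).symm
  · intro q hq e
    have e0 := congrFun e 0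
    have e1 := congrFun e 1
    rw [m0] at e0
    rw [m1] at e1
    obtain ⟨f0, f1⟩ := S.uniq (hq 0) (hq 1) e0 e1
    funext i
    fin_cases i
    · exact f0
    · exact f1
  · have n0 := (fam 0).fz_neg (r 0) (r 0) (hr 0).le (hr 0)
    have n1 := (fam 1).fz_neg (r 1) (r 1) (hr 1).le (hr 1)
    have c0 := (fam 0).contest (r 0) (r 0) (hr 0).le (hr 0)
    have c1 := (fam 1).contest (r 1) (r 1) (hr 1).le (hr 1)
    rw [(fam 0).unit _ (hr 0)] at c0
    rw [(fam 1).unit _ (hr 1)] at c1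
    have hJ : DCS.jac fam r μ p = !![1 + p 0 * (fam 0).fz (r 0) (r 0) * (r 0 * μ 0 0),
        p 0 * (fam 0).fz (r 0) (r 0) * (r 0 * μ 0 1);
        p 1 * (fam 1).fz (r 1) (r 1) * (r 1 * μ 1 0),
        1 + p 1 * (fam 1).fz (r 1) (r 1) * (r 1 * μ 1 1)] := by
      have g1 := S.e1
      have g2 := S.e2
      ext i j
      fin_cases i <;> fin_cases j <;>
        simp [DCS.jac, DCS.F, Fin.sum_univ_two, g1, g2, (fam 0).unit _ (hr 0),
          (fam 1).unit _ (hr 1)]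
    rw [hJ]
    obtain ⟨s, hs⟩ : ∃ s, s = -(r 0 * (fam 0).fz (r 0) (r 0)) := ⟨_, rfl⟩
    obtain ⟨t, ht⟩ : ∃ t, t = -(r 1 * (fam 1).fz (r 1) (r 1)) := ⟨_, rfl⟩
    have s0 : 0 < s := by rw [hs]; nlinarith [mul_pos (hr 0) (neg_pos.mpr n0)]
    have t0 : 0 < t := by rw [ht]; nlinarith [mul_pos (hr 1) (neg_pos.mpr n1)]
    have s1 : s < 1 := by linarith
    have t1 : t < 1 := by linarith
    have ha := S.ha
    have hb := S.hb
    have hc := S.hc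
    have hd := S.hd
    have g1 : s * (μ 0 0 * p 0) + s * (μ 0 1 * p 1) = s := by rw [← mul_add, S.e1, mul_one]
    have g2 : t * (μ 1 0 * p 0) + t * (μ 1 1 * p 1) = t := by rw [← mul_add, S.e2, mul_one]
    have q1 : 0 < s * (μ 0 0 * p 0) := by positivity
    have q2 : 0 < s * (μ 0 1 * p 1) := by positivity
    have q3 : 0 < t * (μ 1 0 * p 0) := by positivity
    have q4 : 0 < t * (μ 1 1 * p 1) := by positivity
    have hst : 0 < s * t * (p 0 * p 1) := by positivity
    obtain ⟨u, v, u0, u1, v0, v1, es, em⟩ := quad_roots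
      (A := 1 - s * (μ 0 0 * p 0)) (D := 1 - t * (μ 1 1 * p 1))
      (B := s * (μ 0 1 * p 1)) (K := t * (μ 1 0 * p 0))
      (by linarith) (by linarith) (by linarith) (by linarith) (by positivity)
      (mul_lt_mul'' (by linarith) (by linarith) q2.le q3.le)
      (by nlinarith [mul_pos hst hdet])
    refine ⟨u, v, u0, u1, v0, v1, ?_⟩
    rw [Matrix.charpoly_fin_two, Matrix.trace_fin_two_of, Matrix.det_fin_two_of]
    have E1 : 1 + p 0 * (fam 0).fz (r 0) (r 0) * (r 0 * μ 0 0) +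
        (1 + p 1 * (fam 1).fz (r 1) (r 1) * (r 1 * μ 1 1)) = u + v := by
      rw [es, hs, ht]; ring
    have E2 : (1 + p 0 * (fam 0).fz (r 0) (r 0) * (r 0 * μ 0 0)) *
        (1 + p 1 * (fam 1).fz (r 1) (r 1) * (r 1 * μ 1 1)) -
        p 0 * (fam 0).fz (r 0) (r 0) * (r 0 * μ 0 1) *
        (p 1 * (fam 1).fz (r 1) (r 1) * (r 1 * μ 1 0)) = u * v := by
      rw [em, hs, ht]; ring
    rw [E1, E2, C_add, C_mul]
    ring
  · intro x hx
    have hpos : ∀ k, 0 < (DCS.map fam r μ)^[k] x 0 ∧ 0 < (DCS.map fam r μ)^[k] x 1 := by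
      intro k
      induction k with
      | zero => exact ⟨hx 0, hx 1⟩
      | succ k ih =>
        rw [Function.iterate_succ_apply', m0, m1]
        obtain ⟨i1, i2⟩ := ih
        have ha := S.ha
        have hb := S.hb
        have hc := S.hc
        have hd := S.hd
        exact ⟨mul_pos i1 (S.H1.pos _ (by positivity)),
          mul_pos i2 (S.H2.pos _ (by positivity))⟩
    have O : Orb (fun w => (fam 0).f (r 0 * w) (r 0)) (fun w => (fam 1).f (r 1 * w) (r 1))
        (μ 0 0) (μ 0 1) (μ 1 0) (μ 1 1) (fun k => (DCS.map fam r μ)^[k] x 0)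
        (fun k => (DCS.map fam r μ)^[k] x 1) :=
      ⟨fun k => (hpos k).1, fun k => (hpos k).2,
        fun k => by simp only [Function.iterate_succ_apply']; rw [m0],
        fun k => by simp only [Function.iterate_succ_apply']; rw [m1]⟩
    obtain ⟨t0, t1⟩ := S.converge O
    rw [tendsto_pi_nhds]
    intro i
    fin_cases i
    · exact t0
    · exact t1
end

section
/- Let T ∈ DCS(2,f) with γ₁₂ < 0 and γ₂₁ < 0. Then T has a unique fixed point p in int ℝ₊²; p is a hyperbolic saddle: DT(p) has two positive real eigenvalues, one in (0,1) and one strictly greater than 1; and for every x ∈ ℝ₊² \ {0}, the orbit (Tᵏx)ₖ≥₀ converges to one of q₍₁₎ = (1/μ₁₁, 0), q₍₂₎ = (0, 1/μ₂₂), or p. -/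
open Set Filter Metric Topology Polynomial

/-- Properties of the one-variable growth function `s ↦ f(r s, r)`. -/
structure Good (φ : ℝ → ℝ) : Prop where
  cont : ContinuousOn φ (Set.Ici 0)
  anti : StrictAntiOn φ (Set.Ici 0)
  pos : ∀ s, 0 ≤ s → 0 < φ s
  one : φ 1 = 1
  mono : StrictMonoOn (fun s => s * φ s) (Set.Ici 0)

lemma strictMonoOn_Ici_of_within {h h' : ℝ → ℝ}
    (hd : ∀ z, 0 ≤ z → HasDerivWithinAt h (h' z) (Set.Ici 0) z)
    (hp : ∀ z, 0 ≤ z → 0 < h' z) : StrictMonoOn h (Set.Ici 0) := by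
  apply strictMonoOn_of_deriv_pos (convex_Ici 0)
  · intro z hz
    exact (hd z hz).continuousWithinAt
  · intro z hz
    rw [interior_Ici] at hz
    have hz' : (0:ℝ) < z := hz
    have := (hd z hz'.le).hasDerivAt (Ici_mem_nhds hz')
    rw [this.deriv]
    exact hp z hz'.le

lemma good_of (g : GrowthF) (r : ℝ) (hr : 0 < r) : Good (fun s => g.f (r * s) r) := by
  have hmaps : ∀ s, s ∈ Set.Ici (0:ℝ) → r * s ∈ Set.Ici (0:ℝ) := fun s hs =>
    mul_nonneg hr.le hs
  have h1 : StrictMonoOn (fun w => - g.f w r) (Set.Ici 0) :=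
    strictMonoOn_Ici_of_within (h' := fun z => - g.fz z r)
      (fun z hz => (g.hasDeriv z r hz hr).neg)
      (fun z hz => by have := g.fz_neg z r hz hr; linarith)
  have h2 : StrictMonoOn (fun w => w * g.f w r) (Set.Ici 0) :=
    strictMonoOn_Ici_of_within (h' := fun z => 1 * g.f z r + z * g.fz z r)
      (fun z hz => (hasDerivWithinAt_id z _).mul (g.hasDeriv z r hz hr))
      (fun z hz => by have := g.contest z r hz hr; linarith)
  refine ⟨?_, ?_, ?_, ?_, ?_⟩
  · have : ContinuousOn (fun w => g.f w r) (Set.Ici 0) :=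
      fun z hz => (g.hasDeriv z r hz hr).continuousWithinAt
    exact this.comp (by fun_prop) hmaps
  · intro s hs t ht hst
    have := h1 (hmaps s hs) (hmaps t ht) (mul_lt_mul_of_pos_left hst hr)
    simp only at this ⊢
    linarith
  · intro s hs
    exact g.pos _ _ (hmaps s hs) hr
  · simp [g.unit r hr]
  · intro s hs t ht hst
    have := h2 (hmaps s hs) (hmaps t ht) (mul_lt_mul_of_pos_left hst hr)
    simp only at this ⊢
    rw [mul_assoc, mul_assoc] at this
    exact lt_of_mul_lt_mul_left this hr.le

/-- Scaling argument. -/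
lemma half {φ : ℝ → ℝ} (h : Good φ) {a b x1 x2 y1 y2 : ℝ} (ha : 0 < a) (hb : 0 < b)
    (hx2 : 0 ≤ x2) (hy1 : 0 ≤ y1) (hy2 : 0 ≤ y2) (hlt : y1 < x1)
    (hr : x2 * y1 ≤ x1 * y2) :
    y1 * φ (a * y1 + b * y2) < x1 * φ (a * x1 + b * x2) := by
  have hx1 : 0 < x1 := lt_of_le_of_lt hy1 hlt
  have hwx : 0 ≤ a * x1 + b * x2 := by positivity
  have hpx := h.pos _ hwx
  rcases hy1.eq_or_lt with h0 | h0
  · rw [← h0, zero_mul]; positivity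
  · set w := a * y1 + b * y2 with hw
    have hwpos : 0 < w := by positivity
    have hle : a * x1 + b * x2 ≤ x1 / y1 * w := by
      rw [div_mul_eq_mul_div, le_div_iff₀ h0]
      nlinarith
    have hl : 1 < x1 / y1 := by rwa [one_lt_div h0]
    have hlw : 0 ≤ x1 / y1 * w := by positivity
    have e1 : φ (x1 / y1 * w) ≤ φ (a * x1 + b * x2) := h.anti.antitoneOn hwx hlw hle
    have e2 : w * φ w < (x1 / y1 * w) * φ (x1 / y1 * w) :=
      h.mono hwpos.le hlw (by nlinarith)
    have e3 : φ w < x1 / y1 * φ (x1 / y1 * w) := by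
      apply lt_of_mul_lt_mul_left _ hwpos.le
      calc _ < _ := e2
        _ = _ := by ring
    have e4 : y1 * φ w < x1 * φ (x1 / y1 * w) := by
      calc y1 * φ w < y1 * (x1 / y1 * φ (x1 / y1 * w)) := mul_lt_mul_of_pos_left e3 h0
        _ = _ := by field_simp
    exact e4.trans_le (mul_le_mul_of_nonneg_left e1 hx1.le)

lemma comp1 {φ : ℝ → ℝ} (h : Good φ) {a b x1 x2 y1 y2 : ℝ} (ha : 0 < a) (hb : 0 < b)
    (hx1 : 0 ≤ x1) (hx2 : 0 ≤ x2) (hy2 : 0 ≤ y2) (h1 : x1 ≤ y1) (h2 : y2 ≤ x2) :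
    x1 * φ (a * x1 + b * x2) ≤ y1 * φ (a * y1 + b * y2) := by
  rcases h1.eq_or_lt with h0 | h0
  · subst h0
    apply mul_le_mul_of_nonneg_left _ hx1
    apply h.anti.antitoneOn
    · show (0:ℝ) ≤ _; positivity
    · show (0:ℝ) ≤ _; positivity
    · nlinarith
  · apply (half h ha hb hy2 hx1 hx2 h0 _).le
    nlinarith

lemma retro1 {φ ψ : ℝ → ℝ} (h : Good φ) (k : Good ψ) {a b c d x1 x2 y1 y2 : ℝ}
    (ha : 0 < a) (hb : 0 < b) (hc : 0 < c) (hd : 0 < d)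
    (hx1 : 0 ≤ x1) (hx2 : 0 ≤ x2) (hy1 : 0 ≤ y1) (hy2 : 0 ≤ y2)
    (h1 : x1 * φ (a * x1 + b * x2) ≤ y1 * φ (a * y1 + b * y2))
    (h2 : x2 * ψ (d * x2 + c * x1) ≤ y2 * ψ (d * y2 + c * y1)) : x1 ≤ y1 := by
  by_contra! hlt
  rcases le_or_gt (x2 * y1) (x1 * y2) with hc1 | hc1
  · exact absurd h1 (half h ha hb hx2 hy1 hy2 hlt hc1).not_ge
  · have : y2 < x2 := by
      by_contra! hh
      nlinarith
    exact absurd h2 (half k hd hc hx1 hy2 hy1 this (by linarith)).not_ge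

lemma bdd1 {φ : ℝ → ℝ} (h : Good φ) {a b x y M : ℝ} (ha : 0 < a) (hb : 0 < b)
    (hx : 0 ≤ x) (hy : 0 ≤ y) (hM : 1 / a ≤ M) (hxM : x ≤ M) :
    x * φ (a * x + b * y) ≤ M := by
  have hM0 : 0 ≤ M := le_trans (by positivity) hM
  have e : x * φ (a * x + b * y) ≤ M * φ (a * M + b * 0) :=
    comp1 h ha hb hx hy le_rfl hxM hy
  have : φ (a * M + b * 0) ≤ φ 1 := by
    apply h.anti.antitoneOn
    · show (0:ℝ) ≤ 1; norm_num
    · show (0:ℝ) ≤ _; positivity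
    · rw [div_le_iff₀ ha] at hM; linarith
  rw [h.one] at this
  nlinarith

lemma conv_of {X : ℕ → ℝ} {M : ℝ} (m : ℕ) (h0 : ∀ k, 0 ≤ X k) (hM : ∀ k, X k ≤ M)
    (h : (∀ k, m ≤ k → X k ≤ X (k+1)) ∨ (∀ k, m ≤ k → X (k+1) ≤ X k)) :
    ∃ u, 0 ≤ u ∧ Tendsto X atTop (𝓝 u) := by
  have : ∃ u, Tendsto (fun k => X (k + m)) atTop (𝓝 u) := by
    rcases h with h | h
    · have hm : Monotone (fun k => X (k + m)) := monotone_nat_of_le_succ fun k => by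
        have := h (k + m) (by omega)
        rwa [show k + m + 1 = k + 1 + m by ring] at this
      exact ⟨_, tendsto_atTop_ciSup hm ⟨M, by rintro _ ⟨k, rfl⟩; exact hM _⟩⟩
    · have hm : Antitone (fun k => X (k + m)) := antitone_nat_of_succ_le fun k => by
        have := h (k + m) (by omega)
        rwa [show k + m + 1 = k + 1 + m by ring] at this
      exact ⟨_, tendsto_atTop_ciInf hm ⟨0, by rintro _ ⟨k, rfl⟩; exact h0 _⟩⟩
  obtain ⟨u, hu⟩ := this
  rw [tendsto_add_atTop_iff_nat] at hu
  exact ⟨u, ge_of_tendsto' hu h0, hu⟩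

lemma dyn {φ ψ : ℝ → ℝ} (h : Good φ) (g : Good ψ) {a b c d : ℝ}
    (ha : 0 < a) (hb : 0 < b) (hc : 0 < c) (hd : 0 < d) {X Y : ℕ → ℝ}
    (hX0 : 0 ≤ X 0) (hY0 : 0 ≤ Y 0)
    (hX : ∀ k, X (k+1) = X k * φ (a * X k + b * Y k))
    (hY : ∀ k, Y (k+1) = Y k * ψ (d * Y k + c * X k)) (hne : 0 < X 0 ∨ 0 < Y 0) :
    ∃ u v, 0 ≤ u ∧ 0 ≤ v ∧ Tendsto X atTop (𝓝 u) ∧ Tendsto Y atTop (𝓝 v) ∧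
      u = u * φ (a * u + b * v) ∧ v = v * ψ (d * v + c * u) ∧ (u ≠ 0 ∨ v ≠ 0) := by
  have hnn : ∀ k, 0 ≤ X k ∧ 0 ≤ Y k := by
    intro k
    induction k with
    | zero => exact ⟨hX0, hY0⟩
    | succ k ih =>
      obtain ⟨i1, i2⟩ := ih
      rw [hX, hY]
      exact ⟨mul_nonneg i1 (h.pos _ (by positivity)).le,
        mul_nonneg i2 (g.pos _ (by positivity)).le⟩
  have hXn := fun k => (hnn k).1
  have hYn := fun k => (hnn k).2
  have hXb : ∀ k, X k ≤ max (X 0) (1 / a) := by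
    intro k
    induction k with
    | zero => exact le_max_left _ _
    | succ k ih =>
      rw [hX]
      exact bdd1 h ha hb (hXn k) (hYn k) (le_max_right _ _) ih
  have hYb : ∀ k, Y k ≤ max (Y 0) (1 / d) := by
    intro k
    induction k with
    | zero => exact le_max_left _ _
    | succ k ih =>
      rw [hY]
      exact bdd1 g hd hc (hYn k) (hXn k) (le_max_right _ _) ih
  -- backward monotonicity
  have up : ∀ k, (X (k+1) ≤ X (k+2) ∧ Y (k+1) ≤ Y (k+2)) → X k ≤ X (k+1) ∧ Y k ≤ Y (k+1) := by
    rintro k ⟨h1, h2⟩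
    rw [hX (k+1), hX k] at h1
    rw [hY (k+1), hY k] at h2
    rw [← hX k] at h1
    rw [← hY k] at h2
    rw [hX k] at h1
    rw [hY k] at h2
    have h1' : X k * φ (a * X k + b * Y k) ≤
        X (k+1) * φ (a * X (k+1) + b * Y (k+1)) := by simpa only [hX, hY] using h1
    have h2' : Y k * ψ (d * Y k + c * X k) ≤
        Y (k+1) * ψ (d * Y (k+1) + c * X (k+1)) := by simpa only [hX, hY] using h2
    exact ⟨retro1 h g ha hb hc hd (hXn _) (hYn _) (hXn _) (hYn _) h1' h2',
      retro1 g h hd hc hb ha (hYn _) (hXn _) (hYn _) (hXn _) h2' h1'⟩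
  have dn : ∀ k, (X (k+2) ≤ X (k+1) ∧ Y (k+2) ≤ Y (k+1)) → X (k+1) ≤ X k ∧ Y (k+1) ≤ Y k := by
    rintro k ⟨h1, h2⟩
    have h1' : X (k+1) * φ (a * X (k+1) + b * Y (k+1)) ≤
        X k * φ (a * X k + b * Y k) := by rw [← hX, ← hX]; exact h1
    have h2' : Y (k+1) * ψ (d * Y (k+1) + c * X (k+1)) ≤
        Y k * ψ (d * Y k + c * X k) := by rw [← hY, ← hY]; exact h2
    exact ⟨retro1 h g ha hb hc hd (hXn _) (hYn _) (hXn _) (hYn _) h1' h2',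
      retro1 g h hd hc hb ha (hYn _) (hXn _) (hYn _) (hXn _) h2' h1'⟩
  have key : ∃ m, ((∀ k, m ≤ k → X k ≤ X (k+1)) ∨ (∀ k, m ≤ k → X (k+1) ≤ X k)) ∧
      ((∀ k, m ≤ k → Y k ≤ Y (k+1)) ∨ (∀ k, m ≤ k → Y (k+1) ≤ Y k)) := by
    by_cases hA : ∀ k, X k ≤ X (k+1) ∧ Y k ≤ Y (k+1)
    · exact ⟨0, Or.inl fun k _ => (hA k).1, Or.inl fun k _ => (hA k).2⟩
    by_cases hB : ∀ k, X (k+1) ≤ X k ∧ Y (k+1) ≤ Y k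
    · exact ⟨0, Or.inr fun k _ => (hB k).1, Or.inr fun k _ => (hB k).2⟩
    obtain ⟨k, hk⟩ := not_forall.mp hA
    obtain ⟨l, hl⟩ := not_forall.mp hB
    have hA' : ∀ j, k ≤ j → ¬ (X j ≤ X (j+1) ∧ Y j ≤ Y (j+1)) := by
      intro j hj
      induction j, hj using Nat.le_induction with
      | base => exact hk
      | succ j hj ih => exact fun hh => ih (up j hh)
    have hB' : ∀ j, l ≤ j → ¬ (X (j+1) ≤ X j ∧ Y (j+1) ≤ Y j) := by
      intro j hj
      induction j, hj using Nat.le_induction with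
      | base => exact hl
      | succ j hj ih => exact fun hh => ih (dn j hh)
    refine ⟨max k l, ?_⟩
    have nA := hA' (max k l) (le_max_left _ _)
    have nB := hB' (max k l) (le_max_right _ _)
    generalize max k l = m at nA nB ⊢
    have : (X m ≤ X (m+1) ∧ Y (m+1) ≤ Y m) ∨ (X (m+1) ≤ X m ∧ Y m ≤ Y (m+1)) := by
      rcases le_total (X m) (X (m+1)) with e1 | e1 <;>
        rcases le_total (Y m) (Y (m+1)) with e2 | e2 <;> tauto
    rcases this with hm | hm
    · have : ∀ j, m ≤ j → X j ≤ X (j+1) ∧ Y (j+1) ≤ Y j := by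
        intro j hj
        induction j, hj using Nat.le_induction with
        | base => exact hm
        | succ j hj ih =>
          have e1 := comp1 h ha hb (hXn _) (hYn _) (hYn _) ih.1 ih.2
          have e2 := comp1 g hd hc (hYn _) (hXn _) (hXn _) ih.2 ih.1
          rw [← hX, ← hX] at e1
          rw [← hY, ← hY] at e2
          exact ⟨e1, e2⟩
      exact ⟨Or.inl fun j hj => (this j hj).1, Or.inr fun j hj => (this j hj).2⟩
    · have : ∀ j, m ≤ j → X (j+1) ≤ X j ∧ Y j ≤ Y (j+1) := by
        intro j hj
        induction j, hj using Nat.le_induction with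
        | base => exact hm
        | succ j hj ih =>
          have e1 := comp1 h ha hb (hXn _) (hYn _) (hYn _) ih.1 ih.2
          have e2 := comp1 g hd hc (hYn _) (hXn _) (hXn _) ih.2 ih.1
          rw [← hX, ← hX] at e1
          rw [← hY, ← hY] at e2
          exact ⟨e1, e2⟩
      exact ⟨Or.inr fun j hj => (this j hj).1, Or.inl fun j hj => (this j hj).2⟩
  obtain ⟨m, kX, kY⟩ := key
  obtain ⟨u, hu0, hu⟩ := conv_of m hXn hXb kX
  obtain ⟨v, hv0, hv⟩ := conv_of m hYn hYb kY
  have limfix : ∀ {χ : ℝ → ℝ} (_ : Good χ) {p q : ℝ} (_ : 0 < p) (_ : 0 < q) {U V : ℕ → ℝ}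
      {s t : ℝ} (_ : ∀ k, 0 ≤ U k) (_ : ∀ k, 0 ≤ V k) (_ : 0 ≤ s) (_ : 0 ≤ t)
      (_ : Tendsto U atTop (𝓝 s)) (_ : Tendsto V atTop (𝓝 t))
      (_ : ∀ k, U (k+1) = U k * χ (p * U k + q * V k)), s = s * χ (p * s + q * t) := by
    intro χ hχ p q hp hq U V s t hU hV hs ht hUs hVt hrec
    have hw : Tendsto (fun k => p * U k + q * V k) atTop (𝓝[Set.Ici 0] (p * s + q * t)) := by
      apply tendsto_nhdsWithin_of_tendsto_nhds_of_eventually_within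
      · exact (hUs.const_mul p).add (hVt.const_mul q)
      · refine Eventually.of_forall fun k => ?_
        have := hU k
        have := hV k
        show (0:ℝ) ≤ _
        positivity
    have hχw := (hχ.cont (p * s + q * t) (by show (0:ℝ) ≤ _; positivity)).tendsto.comp hw
    have h1 := hUs.mul hχw
    have h2 := (tendsto_add_atTop_iff_nat 1).mpr hUs
    refine tendsto_nhds_unique h2 (h1.congr fun k => ?_)
    simp [hrec]
  refine ⟨u, v, hu0, hv0, hu, hv, limfix h ha hb hXn hYn hu0 hv0 hu hv hX,
    limfix g hd hc hYn hXn hv0 hu0 hv hu hY, ?_⟩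
  have nz : ∀ {χ : ℝ → ℝ} (_ : Good χ) {p q : ℝ} (_ : 0 < p) (_ : 0 < q) {U V : ℕ → ℝ}
      (_ : ∀ k, 0 ≤ U k) (_ : ∀ k, 0 ≤ V k)
      (_ : Tendsto U atTop (𝓝 0)) (_ : Tendsto V atTop (𝓝 0))
      (_ : ∀ k, U (k+1) = U k * χ (p * U k + q * V k)) (_ : 0 < U 0), False := by
    intro χ hχ p q hp hq U V hU hV hUs hVt hrec hpos
    have hUp : ∀ k, 0 < U k := by
      intro k
      induction k with
      | zero => exact hpos
      | succ k ih =>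
        rw [hrec]
        have := hV k
        exact mul_pos ih (hχ.pos _ (by positivity))
    have hw : Tendsto (fun k => p * U k + q * V k) atTop (𝓝 0) := by
      simpa using (hUs.const_mul p).add (hVt.const_mul q)
    obtain ⟨N, hN⟩ := eventually_atTop.mp (hw.eventually (gt_mem_nhds one_pos))
    have hmono : ∀ k, N ≤ k → U N ≤ U k := by
      intro k hk
      induction k, hk using Nat.le_induction with
      | base => exact le_rfl
      | succ k hk ih =>
        refine ih.trans ?_
        rw [hrec]
        have := hUp k
        have := hV k
        have e : χ 1 < χ (p * U k + q * V k) :=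
          hχ.anti (by show (0:ℝ) ≤ _; positivity) (by show (0:ℝ) ≤ 1; norm_num) (hN k hk)
        rw [hχ.one] at e
        nlinarith
    have : U N ≤ 0 := ge_of_tendsto hUs (eventually_atTop.mpr ⟨N, hmono⟩)
    exact absurd this (hUp N).not_ge
  by_contra! hz
  obtain ⟨rfl, rfl⟩ := hz
  rcases hne with hp | hp
  · exact nz h ha hb hXn hYn hu hv hX hp
  · exact nz g hd hc hYn hXn hv hu hY hp

lemma good_eq_one {φ : ℝ → ℝ} (h : Good φ) {s u : ℝ} (hs : 0 ≤ s) (hu : u ≠ 0)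
    (e : u = u * φ s) : s = 1 := by
  have : φ s = 1 := by
    have : u * φ s = u * 1 := by linarith
    exact mul_left_cancel₀ hu this
  rw [← h.one] at this
  exact h.anti.injOn hs (by show (0:ℝ) ≤ 1; norm_num) this

lemma cramer {a b c d u v : ℝ} (hdet : 0 < b * c - a * d)
    (h1 : a * u + b * v = 1) (h2 : c * u + d * v = 1) :
    u = (b - d) / (b * c - a * d) ∧ v = (c - a) / (b * c - a * d) := by
  constructor
  · rw [eq_div_iff hdet.ne']
    linear_combination b * h2 - d * h1
  · rw [eq_div_iff hdet.ne']
    linear_combination c * h1 - a * h2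

/-- A real `2×2` matrix with the stated sign pattern has the desired eigenvalues. -/
lemma eig {t D : ℝ} (hD : 0 < D) (h1 : 1 - t + D < 0) :
    ∃ α β : ℝ, 0 < α ∧ α < 1 ∧ 1 < β ∧ α + β = t ∧ α * β = D := by
  have hdisc : (0:ℝ) ≤ t ^ 2 - 4 * D := by nlinarith [sq_nonneg (t - 2)]
  set s := Real.sqrt (t ^ 2 - 4 * D) with hs
  have hss : s ^ 2 = t ^ 2 - 4 * D := Real.sq_sqrt hdisc
  have hs0 : 0 ≤ s := Real.sqrt_nonneg _
  have a1 : s < t := by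
    by_contra! hh
    nlinarith
  have a2 : t - 2 < s := by
    by_contra! hh
    nlinarith
  have a3 : 2 - t < s := by
    by_contra! hh
    nlinarith
  exact ⟨(t - s) / 2, (t + s) / 2, by linarith, by linarith, by linarith, by ring, by nlinarith⟩

/-- For T ∈ DCS(2,f) with γ₁₂ < 0 and γ₂₁ < 0: T has a unique
interior fixed point p, which is a hyperbolic saddle (two positive real
eigenvalues, one in (0,1) and one > 1), and every nonzero orbit in ℝ₊²
converges to q₍₁₎, q₍₂₎ or p. -/
theorem stmt13 (fam : Fin 2 → GrowthF) (r : Fin 2 → ℝ) (μ : Fin 2 → Fin 2 → ℝ)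
    (hr : ∀ i, 0 < r i) (hμ : ∀ i j, 0 < μ i j)
    (hγ12 : μ 0 0 - μ 1 0 < 0) (hγ21 : μ 1 1 - μ 0 1 < 0) :
    ∃ p ∈ intOrthant 2, DCS.map fam r μ p = p ∧
      (∀ q ∈ intOrthant 2, DCS.map fam r μ q = q → q = p) ∧
      (∃ a b : ℝ, 0 < a ∧ a < 1 ∧ 1 < b ∧
        (DCS.jac fam r μ p).charpoly = (X - C a) * (X - C b)) ∧
      (∀ x ∈ orthant 2, x ≠ 0 →
        Tendsto (fun k => (DCS.map fam r μ)^[k] x) atTop (𝓝 (![1 / μ 0 0, 0])) ∨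
        Tendsto (fun k => (DCS.map fam r μ)^[k] x) atTop (𝓝 (![0, 1 / μ 1 1])) ∨
        Tendsto (fun k => (DCS.map fam r μ)^[k] x) atTop (𝓝 p)) := by
  have h := good_of (fam 0) (r 0) (hr 0)
  have g := good_of (fam 1) (r 1) (hr 1)
  have ha := hμ 0 0
  have hb := hμ 0 1
  have hc := hμ 1 0
  have hd := hμ 1 1
  have map0 : ∀ x, DCS.map fam r μ x 0 =
      x 0 * (fun s => (fam 0).f (r 0 * s) (r 0)) (μ 0 0 * x 0 + μ 0 1 * x 1) := by
    intro x; simp [DCS.map, DCS.F, Fin.sum_univ_two]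
  have map1 : ∀ x, DCS.map fam r μ x 1 =
      x 1 * (fun s => (fam 1).f (r 1 * s) (r 1)) (μ 1 1 * x 1 + μ 1 0 * x 0) := by
    intro x; simp [DCS.map, DCS.F, Fin.sum_univ_two, add_comm]
  have hA := (fam 0).contest (r 0) (r 0) (hr 0).le (hr 0)
  have hB := (fam 1).contest (r 1) (r 1) (hr 1).le (hr 1)
  have hA' := (fam 0).fz_neg (r 0) (r 0) (hr 0).le (hr 0)
  have hB' := (fam 1).fz_neg (r 1) (r 1) (hr 1).le (hr 1)
  rw [(fam 0).unit _ (hr 0)] at hA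
  rw [(fam 1).unit _ (hr 1)] at hB
  have hr0 := hr 0
  have hr1 := hr 1
  have hu0 := (fam 0).unit _ (hr 0)
  have hu1 := (fam 1).unit _ (hr 1)
  have hdet : 0 < μ 0 1 * μ 1 0 - μ 0 0 * μ 1 1 := by nlinarith
  set P : ℝ := (μ 0 1 - μ 1 1) / (μ 0 1 * μ 1 0 - μ 0 0 * μ 1 1) with hP
  set Q : ℝ := (μ 1 0 - μ 0 0) / (μ 0 1 * μ 1 0 - μ 0 0 * μ 1 1) with hQ
  have hPp : 0 < P := div_pos (by linarith) hdet
  have hQp : 0 < Q := div_pos (by linarith) hdet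
  have e1 : μ 0 0 * P + μ 0 1 * Q = 1 := by
    rw [hP, hQ, mul_div_assoc', mul_div_assoc', ← add_div, div_eq_one_iff_eq hdet.ne']; ring
  have e2 : μ 1 0 * P + μ 1 1 * Q = 1 := by
    rw [hP, hQ, mul_div_assoc', mul_div_assoc', ← add_div, div_eq_one_iff_eq hdet.ne']; ring
  refine ⟨![P, Q], ?_, ?_, ?_, ?_, ?_⟩
  · intro i; fin_cases i <;> simp [hPp, hQp]
  · funext i
    fin_cases i
    · simp [DCS.map, DCS.F, Fin.sum_univ_two, e1, hu0]
    · simp [DCS.map, DCS.F, Fin.sum_univ_two, e2, hu1]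
  · intro q hq hfix
    have q0 := hq 0
    have q1 := hq 1
    have f0 := map0 q
    have f1 := map1 q
    rw [hfix] at f0 f1
    have s1 := good_eq_one h (by positivity) q0.ne' f0
    have s2 := good_eq_one g (by positivity) q1.ne' f1
    obtain ⟨c1, c2⟩ := cramer hdet s1 (by linarith : μ 1 0 * q 0 + μ 1 1 * q 1 = 1)
    funext i
    fin_cases i
    · simpa using c1
    · simpa using c2
  · obtain ⟨A, hAd⟩ : ∃ A, A = -(r 0 * (fam 0).fz (r 0) (r 0)) := ⟨_, rfl⟩
    obtain ⟨B, hBd⟩ : ∃ B, B = -(r 1 * (fam 1).fz (r 1) (r 1)) := ⟨_, rfl⟩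
    have A0 : 0 < A := by rw [hAd]; nlinarith
    have B0 : 0 < B := by rw [hBd]; nlinarith
    have A1 : A < 1 := by linarith
    have B1 : B < 1 := by linarith
    have jeq : DCS.jac fam r μ ![P, Q] = !![1 - A * (μ 0 0 * P), -(A * μ 0 1 * P);
        -(B * μ 1 0 * Q), 1 - B * (μ 1 1 * Q)] := by
      ext i j
      fin_cases i <;> fin_cases j <;>
        simp [DCS.jac, DCS.F, Fin.sum_univ_two, e1, e2, hu0, hu1, hAd, hBd] <;> ring
    have u1 : 0 < 1 - μ 0 0 * P := by
      have : 0 < μ 0 1 * Q := by positivity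
      linarith
    have v1 : 0 < 1 - μ 1 1 * Q := by
      have : 0 < μ 1 0 * P := by positivity
      linarith
    have hbc : (1 - μ 0 0 * P) * (1 - μ 1 1 * Q) = μ 0 1 * μ 1 0 * P * Q := by
      rw [show 1 - μ 0 0 * P = μ 0 1 * Q by linarith, show 1 - μ 1 1 * Q = μ 1 0 * P by linarith]
      ring
    have hD : 0 < (1 - A * (μ 0 0 * P)) * (1 - B * (μ 1 1 * Q))
        - (-(A * μ 0 1 * P)) * (-(B * μ 1 0 * Q)) := by
      have k1 : A * (1 - μ 0 0 * P) < 1 - A * (μ 0 0 * P) := by linarith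
      have k2 : B * (1 - μ 1 1 * Q) < 1 - B * (μ 1 1 * Q) := by linarith
      have := mul_lt_mul'' k1 k2 (by positivity) (by positivity)
      have e : (-(A * μ 0 1 * P)) * (-(B * μ 1 0 * Q)) =
          A * (1 - μ 0 0 * P) * (B * (1 - μ 1 1 * Q)) := by
        linear_combination -(A * B) * hbc
      linarith
    have hT : 1 - ((1 - A * (μ 0 0 * P)) + (1 - B * (μ 1 1 * Q))) +
        ((1 - A * (μ 0 0 * P)) * (1 - B * (μ 1 1 * Q))
        - (-(A * μ 0 1 * P)) * (-(B * μ 1 0 * Q))) < 0 := by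
      have : 0 < A * B * P * Q * (μ 0 1 * μ 1 0 - μ 0 0 * μ 1 1) := by positivity
      linarith
    obtain ⟨α, β, h1, h2, h3, h4, h5⟩ := eig hD hT
    refine ⟨α, β, h1, h2, h3, ?_⟩
    rw [jeq, Matrix.charpoly_fin_two, Matrix.trace_fin_two, Matrix.det_fin_two]
    simp only [Matrix.of_apply, Matrix.cons_val', Matrix.cons_val_zero, Matrix.cons_val_one,
      Matrix.cons_val_fin_one]
    rw [← h4, ← h5, C_add, C_mul]
    ring
  · intro x hx hx0
    have hne : 0 < x 0 ∨ 0 < x 1 := by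
      by_contra! hh
      apply hx0
      funext i
      fin_cases i
      · exact le_antisymm hh.1 (hx 0)
      · exact le_antisymm hh.2 (hx 1)
    obtain ⟨u, v, hu0', hv0', hu, hv, fu, fv, hnz⟩ := dyn h g ha hb hc hd
      (X := fun k => (DCS.map fam r μ)^[k] x 0) (Y := fun k => (DCS.map fam r μ)^[k] x 1)
      (hx 0) (hx 1)
      (fun k => by
        simp only [Function.iterate_succ_apply']
        exact map0 _)
      (fun k => by
        simp only [Function.iterate_succ_apply']
        exact map1 _) hne
    have lim : Tendsto (fun k => (DCS.map fam r μ)^[k] x) atTop (𝓝 (![u, v])) := by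
      rw [tendsto_pi_nhds]
      intro i
      fin_cases i
      · simpa using hu
      · simpa using hv
    by_cases zu : u = 0
    · have zv : v ≠ 0 := by tauto
      have s2 := good_eq_one g (by positivity) zv fv
      right; left
      have : v = 1 / μ 1 1 := by
        rw [eq_div_iff hd.ne', ← s2, zu]; ring
      rw [← this, ← zu]
      exact lim
    · have s1 := good_eq_one h (by positivity) zu fu
      by_cases zv : v = 0
      · left
        have : u = 1 / μ 0 0 := by
          rw [eq_div_iff ha.ne', ← s1, zv]; ring
        rw [← this, ← zv]
        exact lim
      · have s2 := good_eq_one g (by positivity) zv fv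
        obtain ⟨c1, c2⟩ := cramer hdet s1 (by linarith : μ 1 0 * u + μ 1 1 * v = 1)
        right; right
        rw [hP, hQ, ← c1, ← c2]
        exact lim
end

section
/- Let T ∈ DCS(2,f) with γ₁₂ ≠ 0 and γ₂₁ ≠ 0. Then T is permanent if and only if γ₁₂ > 0 and γ₂₁ > 0. -/
open Set Filter Metric Topology Polynomial

/-- One-variable growth profile. -/
structure GoodG_s14 (g : ℝ → ℝ) : Prop where
  pos : ∀ s, 0 ≤ s → 0 < g s
  one : g 1 = 1
  anti : ∀ s t, 0 ≤ s → s < t → g t < g s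
  mono : ∀ s t, 0 ≤ s → s ≤ t → s * g s ≤ t * g t

theorem GrowthF.good_s14 (F : GrowthF) (r : ℝ) (hr : 0 < r) :
    GoodG_s14 (fun s => F.f (r * s) r) := by
  have hd : ∀ z, 0 < z → HasDerivAt (fun w => F.f w r) (F.fz z r) z := fun z hz =>
    (F.hasDeriv z r hz.le hr).hasDerivAt (Ici_mem_nhds hz)
  have hc : ContinuousOn (fun w => F.f w r) (Set.Ici 0) := fun z hz =>
    (F.hasDeriv z r hz hr).continuousWithinAt
  have h1 : StrictAntiOn (fun w => F.f w r) (Set.Ici 0) := by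
    apply strictAntiOn_of_deriv_neg (convex_Ici 0) hc
    intro z hz
    rw [interior_Ici] at hz
    rw [(hd z hz).deriv]
    exact F.fz_neg z r (le_of_lt hz) hr
  have h2 : StrictMonoOn (fun w => w * F.f w r) (Set.Ici 0) := by
    apply strictMonoOn_of_deriv_pos (convex_Ici 0) (continuousOn_id.mul hc)
    intro z hz
    rw [interior_Ici] at hz
    have := ((hasDerivAt_id z).mul (hd z hz)).deriv
    have h3 := F.contest z r (le_of_lt hz) hr
    rw [this, id_eq]; linarith
  refine ⟨fun s hs => F.pos _ _ (by positivity) hr, by simpa using F.unit r hr, ?_, ?_⟩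
  · intro s t hs hst
    have ht : 0 ≤ t := hs.trans hst.le
    exact h1 (show (0:ℝ) ≤ r * s by positivity) (show (0:ℝ) ≤ r * t by positivity)
      (mul_lt_mul_of_pos_left hst hr)
  · intro s t hs hst
    have ht : 0 ≤ t := hs.trans hst
    have h := h2.monotoneOn (show (0:ℝ) ≤ r * s by positivity)
      (show (0:ℝ) ≤ r * t by positivity) (mul_le_mul_of_nonneg_left hst hr.le)
    have h' : r * (s * F.f (r * s) r) ≤ r * (t * F.f (r * t) r) := by
      have h0 : r * s * F.f (r * s) r ≤ r * t * F.f (r * t) r := h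
      linarith
    exact le_of_mul_le_mul_left h' hr

theorem GoodG_s14.anti_le {g : ℝ → ℝ} (hg : GoodG_s14 g) (s t : ℝ) (hs : 0 ≤ s) (h : s ≤ t) :
    g t ≤ g s := by
  rcases h.eq_or_lt with rfl | h
  · exact le_rfl
  · exact (hg.anti s t hs h).le

theorem GoodG_s14.comp {g : ℝ → ℝ} (hg : GoodG_s14 g) {a k x y : ℝ} (ha : 0 < a) (hk : 0 ≤ k)
    (hx : 0 < x) (hxy : x ≤ y) : x * g (a * x + k) ≤ y * g (a * y + k) := by
  have hs : 0 < a * x + k := by positivity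
  have hst : a * x + k ≤ a * y + k := by nlinarith
  have ht := hs.trans_le hst
  have h := hg.mono _ _ hs.le hst
  have hp := hg.pos _ hs.le
  have hy := hx.trans_le hxy
  have h1 := mul_le_mul_of_nonneg_left h hy.le
  have h2 : x * (a * y + k) ≤ y * (a * x + k) := by nlinarith
  have h3 := mul_le_mul_of_nonneg_right h2 hp.le
  refine le_of_mul_le_mul_left ?_ ht
  linarith

theorem ev_upper (u : ℕ → ℝ) (M q : ℝ) (N : ℕ) (hM : 0 < M) (hq0 : 0 ≤ q) (hq : q < 1)
    (h1 : ∀ n ≥ N, u n ≤ M → u (n+1) ≤ M) (h2 : ∀ n ≥ N, M < u n → u (n+1) ≤ q * u n) :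
    ∃ m ≥ N, ∀ n ≥ m, u n ≤ M := by
  by_cases h : ∃ m ≥ N, u m ≤ M
  · obtain ⟨m, hm, hu⟩ := h
    refine ⟨m, hm, fun n hn => ?_⟩
    induction n, hn using Nat.le_induction with
    | base => exact hu
    | succ n hn ih => exact h1 n (hm.trans hn) ih
  · push Not at h
    exfalso
    have hk : ∀ k, u (N + k) ≤ q ^ k * u N := by
      intro k
      induction k with
      | zero => simp
      | succ k ih =>
        have := h2 (N+k) (by omega) (h _ (by omega))
        have := mul_le_mul_of_nonneg_left ih hq0
        rw [← add_assoc, pow_succ]; linarith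
    have ht : Tendsto (fun k => q ^ k * u N) atTop (𝓝 (0 * u N)) :=
      (tendsto_pow_atTop_nhds_zero_of_lt_one hq0 hq).mul_const _
    have : M ≤ 0 * u N := ge_of_tendsto' ht (fun k => (h _ (by omega)).le.trans (hk k))
    linarith

theorem ev_lower (u : ℕ → ℝ) (M q : ℝ) (N : ℕ) (hu : 0 < u N) (hq : 1 < q)
    (h1 : ∀ n ≥ N, M ≤ u n → M ≤ u (n+1)) (h2 : ∀ n ≥ N, u n < M → q * u n ≤ u (n+1)) :
    ∃ m ≥ N, ∀ n ≥ m, M ≤ u n := by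
  by_cases h : ∃ m ≥ N, M ≤ u m
  · obtain ⟨m, hm, hu⟩ := h
    refine ⟨m, hm, fun n hn => ?_⟩
    induction n, hn using Nat.le_induction with
    | base => exact hu
    | succ n hn ih => exact h1 n (hm.trans hn) ih
  · push Not at h
    exfalso
    have hk : ∀ k, q ^ k * u N ≤ u (N + k) := by
      intro k
      induction k with
      | zero => simp
      | succ k ih =>
        have := h2 (N+k) (by omega) (h _ (by omega))
        have := mul_le_mul_of_nonneg_left ih (by linarith : 0 ≤ q)
        rw [← add_assoc, pow_succ]; linarith
    obtain ⟨k, hk'⟩ := pow_unbounded_of_one_lt (M / u N) hq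
    rw [div_lt_iff₀ hu] at hk'
    have := hk k
    have := h (N + k) (by omega)
    linarith

/-- If `a < c`, some orbit converges to the axis. -/
theorem excl {g₁ g₂ : ℝ → ℝ} (hg₁ : GoodG_s14 g₁) (hg₂ : GoodG_s14 g₂) {a b c d : ℝ} (ha : 0 < a)
    (hb : 0 < b) (hd : 0 < d) (hac : a < c) :
    ∃ x₀ y₀ : ℝ, 0 < x₀ ∧ 0 < y₀ ∧ ∀ x y : ℕ → ℝ, x 0 = x₀ → y 0 = y₀ →
      (∀ n, x (n+1) = x n * g₁ (a * x n + b * y n)) →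
      (∀ n, y (n+1) = y n * g₂ (d * y n + c * x n)) → Tendsto y atTop (𝓝 0) := by
  have hc := ha.trans hac
  obtain ⟨x₀, h1, h2⟩ := exists_between (one_div_lt_one_div_of_lt ha hac)
  have hx₀ : 0 < x₀ := lt_trans (by positivity) h1
  rw [div_lt_iff₀ hc] at h1
  rw [lt_div_iff₀ ha] at h2
  set q := g₂ (c * x₀) with hqd
  have hq0 : 0 < q := hg₂.pos _ (by positivity)
  have hq1 : q < 1 := by
    rw [← hg₂.one]; exact hg₂.anti _ _ zero_le_one (by linarith)
  refine ⟨x₀, (1 - a * x₀) / b, hx₀, div_pos (by linarith) hb, fun x y hx0 hy0 hx hy => ?_⟩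
  set e := (1 - a * x₀) / b with he
  have he0 : 0 < e := div_pos (by linarith) hb
  have hbe : b * e = 1 - a * x₀ := by rw [he]; field_simp
  have key : ∀ n, x₀ ≤ x n ∧ 0 < y n ∧ y n ≤ e * q ^ n := by
    intro n
    induction n with
    | zero => simp [hx0, hy0, he0]
    | succ n ih =>
      obtain ⟨i1, i2, i3⟩ := ih
      have hye : y n ≤ e := i3.trans (mul_le_of_le_one_right he0.le (pow_le_one₀ hq0.le hq1.le))
      have hxn : 0 < x n := hx₀.trans_le i1
      refine ⟨?_, ?_, ?_⟩
      · rw [hx]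
        refine le_trans ?_ (hg₁.comp ha (by positivity) hx₀ i1)
        have : 1 ≤ g₁ (a * x₀ + b * y n) := by
          rw [← hg₁.one]
          exact hg₁.anti_le _ _ (by positivity) (by nlinarith)
        nlinarith
      · rw [hy]; exact mul_pos i2 (hg₂.pos _ (by positivity))
      · rw [hy]
        have : g₂ (d * y n + c * x n) ≤ q :=
          hg₂.anti_le _ _ (by positivity) (by nlinarith)
        calc y n * g₂ (d * y n + c * x n) ≤ y n * q := by gcongr
          _ ≤ e * q ^ n * q := by gcongr
          _ = _ := by ring
  refine squeeze_zero (fun n => (key n).2.1.le) (fun n => (key n).2.2) ?_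
  simpa using (tendsto_pow_atTop_nhds_zero_of_lt_one hq0.le hq1).const_mul e

/-- Upper bound step. -/
theorem step_upper {g : ℝ → ℝ} (hg : GoodG_s14 g) {a b x y M : ℝ} (ha : 0 < a) (hb : 0 < b)
    (hx : 0 < x) (hy : 0 < y) (hM : 0 < M) (haM : 1 < a * M) (h : x ≤ M) :
    x * g (a * x + b * y) ≤ M := by
  have h1 := hg.comp (k := b * y) ha (by positivity) hx h
  have : g (a * M + b * y) ≤ 1 := by
    rw [← hg.one]
    exact hg.anti_le _ _ zero_le_one (by nlinarith [mul_pos hb hy])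
  nlinarith

/-- Lower bound step. -/
theorem step_lower {g : ℝ → ℝ} (hg : GoodG_s14 g) {a b x y m M : ℝ} (ha : 0 < a) (hb : 0 < b)
    (hy : 0 < y) (hm : 0 < m) (hyM : y ≤ M) (hmM : a * m + b * M < 1) (h : m ≤ x) :
    m ≤ x * g (a * x + b * y) := by
  have h1 := hg.comp (k := b * y) ha (by positivity) hm h
  have : 1 ≤ g (a * m + b * y) := by
    rw [← hg.one]
    exact hg.anti_le _ _ (by positivity) (by nlinarith)
  nlinarith

theorem abs_upper {g : ℝ → ℝ} (hg : GoodG_s14 g) {a b M : ℝ} (ha : 0 < a) (hb : 0 < b)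
    (hM : 0 < M) (haM : 1 < a * M) (x y : ℕ → ℝ) (hx : ∀ n, 0 < x n) (hy : ∀ n, 0 < y n)
    (h : ∀ n, x (n+1) = x n * g (a * x n + b * y n)) : ∃ m, ∀ n ≥ m, x n ≤ M := by
  obtain ⟨m, -, hm⟩ := ev_upper x M (g (a * M)) 0 hM (hg.pos _ (by positivity)).le
    (by rw [← hg.one]; exact hg.anti _ _ zero_le_one haM)
    (fun n _ hn => by rw [h]; exact step_upper hg ha hb (hx n) (hy n) hM haM hn)
    (fun n _ hn => by
      rw [h, mul_comm]
      have := hx n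
      have := mul_pos hb (hy n)
      gcongr
      exact hg.anti_le _ _ (by positivity) (by nlinarith))
  exact ⟨m, hm⟩

theorem abs_lower {g : ℝ → ℝ} (hg : GoodG_s14 g) {a b m M : ℝ} (ha : 0 < a) (hb : 0 < b)
    (hm : 0 < m) (hM : 0 < M) (hmM : a * m + b * M < 1) (x y : ℕ → ℝ) (hx : ∀ n, 0 < x n)
    (hy : ∀ n, 0 < y n) (N : ℕ) (hyM : ∀ n ≥ N, y n ≤ M)
    (h : ∀ n, x (n+1) = x n * g (a * x n + b * y n)) : ∃ k, ∀ n ≥ k, m ≤ x n := by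
  obtain ⟨k, -, hk⟩ := ev_lower x m (g (a * m + b * M)) N (hx N)
    (by rw [← hg.one]; exact hg.anti _ _ (by positivity) hmM)
    (fun n hN hn => by rw [h]; exact step_lower hg ha hb (hy n) hm (hyM n hN) hmM hn)
    (fun n hN hn => by
      rw [h, mul_comm]
      have := hx n
      have := hy n
      gcongr
      exact hg.anti_le _ _ (by positivity) (by nlinarith [hyM n hN]))
  exact ⟨k, hk⟩

/-- Constants for the absorbing box. -/
theorem exists_M {b d : ℝ} (hb : 0 < b) (hbd : b < d) : ∃ M : ℝ, 0 < M ∧ 1 < d * M ∧ b * M < 1 := by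
  have hd := hb.trans hbd
  obtain ⟨M, h1, h2⟩ := exists_between (one_div_lt_one_div_of_lt hb hbd)
  refine ⟨M, lt_trans (by positivity) h1, ?_, ?_⟩
  · rw [div_lt_iff₀ hd] at h1; linarith
  · rw [lt_div_iff₀ hb] at h2; linarith

theorem exists_m {a s : ℝ} (ha : 0 < a) (hs : s < 1) : ∃ m : ℝ, 0 < m ∧ a * m + s < 1 := by
  refine ⟨(1 - s) / (2 * a), div_pos (by linarith) (by positivity), ?_⟩
  have : a * ((1 - s) / (2 * a)) = (1 - s) / 2 := by field_simp
  rw [this]; linarith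

theorem no_tendsto {T : (Fin 2 → ℝ) → (Fin 2 → ℝ)} (hT : Permanent T) (z : Fin 2 → ℝ)
    (hz : z ∈ intOrthant 2) (i : Fin 2)
    (ht : Tendsto (fun n => (T^[n] z) i) atTop (𝓝 0)) : False := by
  obtain ⟨K, hK, hKi, -, habs⟩ := hT
  obtain ⟨m, -, hm⟩ := habs z hz
  have hC : IsClosed ((fun p : Fin 2 → ℝ => p i) '' K) :=
    (hK.image (continuous_apply i)).isClosed
  have : (0:ℝ) ∈ (fun p : Fin 2 → ℝ => p i) '' K :=
    hC.mem_of_tendsto ht (eventually_atTop.2 ⟨m, fun k hk => ⟨_, hm k hk, rfl⟩⟩)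
  obtain ⟨p, hp, h0⟩ := this
  have := hKi hp i
  simp only at h0
  linarith

/-- For T ∈ DCS(2,f) with γ₁₂ ≠ 0 and γ₂₁ ≠ 0: T is permanent
if and only if γ₁₂ > 0 and γ₂₁ > 0. -/
theorem stmt14 (fam : Fin 2 → GrowthF) (r : Fin 2 → ℝ) (μ : Fin 2 → Fin 2 → ℝ)
    (hr : ∀ i, 0 < r i) (hμ : ∀ i j, 0 < μ i j)
    (hγ12 : μ 0 0 - μ 1 0 ≠ 0) (hγ21 : μ 1 1 - μ 0 1 ≠ 0) :
    Permanent (DCS.map fam r μ) ↔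
      (0 < μ 0 0 - μ 1 0 ∧ 0 < μ 1 1 - μ 0 1) := by
  have hg := fun i => (fam i).good_s14 (r i) (hr i)
  set g : Fin 2 → ℝ → ℝ := fun i s => (fam i).f (r i * s) (r i) with hgdef
  set T := DCS.map fam r μ with hT
  have hT0 : ∀ z, T z 0 = z 0 * g 0 (μ 0 0 * z 0 + μ 0 1 * z 1) := fun z => by
    simp [hT, DCS.map, DCS.F, hgdef, Fin.sum_univ_two]
  have hT1 : ∀ z, T z 1 = z 1 * g 1 (μ 1 1 * z 1 + μ 1 0 * z 0) := fun z => by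
    simp [hT, DCS.map, DCS.F, hgdef, Fin.sum_univ_two, add_comm]
  have hg0 : GoodG_s14 (g 0) := hg 0
  have hg1 : GoodG_s14 (g 1) := hg 1
  clear_value T g
  have hs0 : ∀ z n, (T^[n+1] z) 0
      = (T^[n] z) 0 * g 0 (μ 0 0 * (T^[n] z) 0 + μ 0 1 * (T^[n] z) 1) := fun z n => by
    rw [Function.iterate_succ_apply', hT0]
  have hs1 : ∀ z n, (T^[n+1] z) 1
      = (T^[n] z) 1 * g 1 (μ 1 1 * (T^[n] z) 1 + μ 1 0 * (T^[n] z) 0) := fun z n => by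
    rw [Function.iterate_succ_apply', hT1]
  constructor
  · intro hP
    constructor
    · by_contra hcon
      have hlt : μ 0 0 < μ 1 0 := by
        rcases lt_or_gt_of_ne hγ12 with h | h
        · linarith
        · exact absurd h hcon
      obtain ⟨x₀, y₀, hx, hy, H⟩ := excl hg0 hg1 (hμ 0 0) (hμ 0 1) (hμ 1 1) hlt
      refine no_tendsto hP ![x₀, y₀] ?_ 1
        (H (fun n => (T^[n] ![x₀, y₀]) 0) _ (by simp) (by simp) (hs0 _) (hs1 _))
      intro i; fin_cases i <;> simpa
    · by_contra hcon
      have hlt : μ 1 1 < μ 0 1 := by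
        rcases lt_or_gt_of_ne hγ21 with h | h
        · linarith
        · exact absurd h hcon
      obtain ⟨x₀, y₀, hx, hy, H⟩ := excl hg1 hg0 (hμ 1 1) (hμ 1 0) (hμ 0 0) hlt
      refine no_tendsto hP ![y₀, x₀] ?_ 0
        (H (fun n => (T^[n] ![y₀, x₀]) 1) _ (by simp) (by simp) (hs1 _) (hs0 _))
      intro i; fin_cases i <;> simpa
  · rintro ⟨h1, h2⟩
    obtain ⟨M0, hM0, ha0, hb0⟩ := exists_M (hμ 1 0) (sub_pos.1 h1)
    obtain ⟨M1, hM1, ha1, hb1⟩ := exists_M (hμ 0 1) (sub_pos.1 h2)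
    obtain ⟨m0, hm0, hc0⟩ := exists_m (hμ 0 0) hb1
    obtain ⟨m1, hm1, hc1⟩ := exists_m (hμ 1 1) hb0
    refine ⟨Set.Icc ![m0, m1] ![M0, M1], isCompact_Icc, ?_, ?_, ?_⟩
    · rintro z ⟨hz, -⟩ i
      have h := hz i
      fin_cases i
      · exact hm0.trans_le h
      · exact hm1.trans_le h
    · rintro _ ⟨z, ⟨hz, hz'⟩, rfl⟩
      have l0 : m0 ≤ z 0 := hz 0
      have l1 : m1 ≤ z 1 := hz 1
      have u0 : z 0 ≤ M0 := hz' 0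
      have u1 : z 1 ≤ M1 := hz' 1
      have p0 := hm0.trans_le l0
      have p1 := hm1.trans_le l1
      constructor
      · intro i
        fin_cases i
        · show m0 ≤ T z 0
          rw [hT0]; exact step_lower hg0 (hμ 0 0) (hμ 0 1) p1 hm0 u1 hc0 l0
        · show m1 ≤ T z 1
          rw [hT1]; exact step_lower hg1 (hμ 1 1) (hμ 1 0) p0 hm1 u0 hc1 l1
      · intro i
        fin_cases i
        · show T z 0 ≤ M0
          rw [hT0]; exact step_upper hg0 (hμ 0 0) (hμ 0 1) p0 p1 hM0 ha0 u0
        · show T z 1 ≤ M1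
          rw [hT1]; exact step_upper hg1 (hμ 1 1) (hμ 1 0) p1 p0 hM1 ha1 u1
    · intro z hz
      have hpos : ∀ n, 0 < (T^[n] z) 0 ∧ 0 < (T^[n] z) 1 := by
        intro n
        induction n with
        | zero => exact ⟨hz 0, hz 1⟩
        | succ n ih =>
          obtain ⟨i0, i1⟩ := ih
          have := hμ 0 0
          have := hμ 0 1
          have := hμ 1 0
          have := hμ 1 1
          rw [hs0, hs1]
          exact ⟨mul_pos i0 (hg0.pos _ (by positivity)), mul_pos i1 (hg1.pos _ (by positivity))⟩
      have hp0 := fun n => (hpos n).1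
      have hp1 := fun n => (hpos n).2
      obtain ⟨A, hA⟩ := abs_upper hg0 (hμ 0 0) (hμ 0 1) hM0 ha0 (fun n => (T^[n] z) 0)
        (fun n => (T^[n] z) 1) hp0 hp1 (hs0 z)
      obtain ⟨B, hB⟩ := abs_upper hg1 (hμ 1 1) (hμ 1 0) hM1 ha1 (fun n => (T^[n] z) 1)
        (fun n => (T^[n] z) 0) hp1 hp0 (hs1 z)
      obtain ⟨C, hC⟩ := abs_lower hg0 (hμ 0 0) (hμ 0 1) hm0 hM1 hc0 (fun n => (T^[n] z) 0)
        (fun n => (T^[n] z) 1) hp0 hp1 B hB (hs0 z)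
      obtain ⟨D, hD⟩ := abs_lower hg1 (hμ 1 1) (hμ 1 0) hm1 hM0 hc1 (fun n => (T^[n] z) 1)
        (fun n => (T^[n] z) 0) hp1 hp0 A hA (hs1 z)
      refine ⟨A + B + C + D + 1, by omega, fun k hk => ⟨?_, ?_⟩⟩
      · intro i
        fin_cases i
        · exact hC k (by omega)
        · exact hD k (by omega)
      · intro i
        fin_cases i
        · exact hA k (by omega)
        · exact hB k (by omega)
end

section
/- Let T ∈ DCS(3,f) and let {i, j, k} = {1, 2, 3} be distinct indices. If γⱼₖ·γₖⱼ > 0, then T has exactly one fixed point v₍ᵢ₎ in the interior of the coordinate plane πᵢ, i.e., in {x ∈ ℝ₊³ : xᵢ = 0, xⱼ > 0, xₖ > 0}; if γⱼₖ·γₖⱼ < 0, then T has no fixed point in that set. Moreover, when γⱼₖ < 0 and γₖⱼ < 0, the Jacobian of the restriction T|πᵢ at v₍ᵢ₎ has one eigenvalue in (0,1) and one eigenvalue greater than 1, while when γⱼₖ > 0 and γₖⱼ > 0 both of these eigenvalues lie in (0,1). -/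
open Set Filter Metric Topology Polynomial

lemma GrowthF.f_eq_one_iff (g : GrowthF) {z r : ℝ} (hz : 0 ≤ z) (hr : 0 < r) :
    g.f z r = 1 ↔ z = r := by
  have hanti : StrictAntiOn (fun w => g.f w r) (Set.Ici 0) := by
    apply strictAntiOn_of_deriv_neg (convex_Ici 0)
    · intro w hw
      exact (g.hasDeriv w r hw hr).continuousWithinAt
    · intro w hw
      rw [interior_Ici] at hw
      have hw' : (0 : ℝ) < w := hw
      rw [((g.hasDeriv w r hw'.le hr).hasDerivAt (Ici_mem_nhds hw')).deriv]
      exact g.fz_neg w r hw'.le hr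
  constructor
  · intro h
    exact hanti.injOn (Set.mem_Ici.2 hz) (Set.mem_Ici.2 hr.le) (by simpa [g.unit r hr] using h)
  · rintro rfl
    exact g.unit _ hr

lemma sum_three (i j k : Fin 3) (hij : i ≠ j) (hik : i ≠ k) (hjk : j ≠ k) (g : Fin 3 → ℝ) :
    ∑ l, g l = g i + (g j + g k) := by
  have h : (Finset.univ : Finset (Fin 3)) = {i, j, k} := by
    revert i j k; decide
  rw [h, Finset.sum_insert (by simp [hij, hik]), Finset.sum_insert (by simp [hjk]),
    Finset.sum_singleton]

lemma fixed_iff (fam : Fin 3 → GrowthF) (r : Fin 3 → ℝ) (μ : Fin 3 → Fin 3 → ℝ)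
    (hr : ∀ i, 0 < r i) (hμ : ∀ i j, 0 < μ i j)
    (i j k : Fin 3) (hij : i ≠ j) (hik : i ≠ k) (hjk : j ≠ k)
    (v : Fin 3 → ℝ) (hi : v i = 0) (hj : 0 < v j) (hk : 0 < v k) :
    DCS.map fam r μ v = v ↔
      (μ j j * v j + μ j k * v k = 1 ∧ μ k j * v j + μ k k * v k = 1) := by
  have hs : ∀ m, ∑ l, μ m l * v l = μ m j * v j + μ m k * v k := by
    intro m
    rw [sum_three i j k hij hik hjk, hi]; ring
  have key : ∀ m, 0 < v m → (DCS.map fam r μ v m = v m ↔ μ m j * v j + μ m k * v k = 1) := by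
    intro m hm
    have h1 := hμ m j
    have h2 := hμ m k
    have h3 := hr m
    unfold DCS.map DCS.F
    rw [hs, mul_eq_left₀ hm.ne', (fam m).f_eq_one_iff (by positivity) h3,
      mul_eq_left₀ h3.ne']
  constructor
  · intro h
    exact ⟨(key j hj).1 (congrFun h j), (key k hk).1 (congrFun h k)⟩
  · rintro ⟨h1, h2⟩
    funext m
    have hm : m = i ∨ m = j ∨ m = k := by
      clear * - hij hik hjk
      revert i j k m; decide
    rcases hm with rfl | rfl | rfl
    · simp [DCS.map, hi]
    · exact (key _ hj).2 h1
    · exact (key _ hk).2 h2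

lemma exists_roots (t d : ℝ) (h : 0 ≤ t ^ 2 - 4 * d) :
    ∃ a b : ℝ, a ≤ b ∧ a + b = t ∧ a * b = d := by
  have h1 := Real.sq_sqrt h
  have h2 := Real.sqrt_nonneg (t ^ 2 - 4 * d)
  refine ⟨(t - √(t ^ 2 - 4 * d)) / 2, (t + √(t ^ 2 - 4 * d)) / 2, by linarith, by ring, by nlinarith⟩

/-- Eigenvalue facts at a fixed point, `α, β ∈ (0,1)`. -/
lemma eig_aux (M : Matrix (Fin 2) (Fin 2) ℝ) (p q s t x y α β : ℝ)
    (hp : 0 < p) (hq : 0 < q) (hs : 0 < s) (ht : 0 < t) (hx : 0 < x) (hy : 0 < y)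
    (hα : 0 < α) (hα1 : α < 1) (hβ : 0 < β) (hβ1 : β < 1)
    (e1 : p * x + q * y = 1) (e2 : s * x + t * y = 1)
    (h00 : M 0 0 = 1 - α * (x * p)) (h01 : M 0 1 = - (α * (x * q)))
    (h10 : M 1 0 = - (β * (y * s))) (h11 : M 1 1 = 1 - β * (y * t)) :
    ∃ a b : ℝ, a ≤ b ∧ 0 < a + b ∧ a + b < 2 ∧ 0 < a * b ∧
      (1 - a) * (1 - b) = α * β * y * (t - q) ∧ M.charpoly = (X - C a) * (X - C b) := by
  have hxp : 0 < x * p := by positivity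
  have hyt : 0 < y * t := by positivity
  have hyq : 0 < y * q := by positivity
  have hxs : 0 < x * s := by positivity
  obtain ⟨a, b, hab, hsum, hprod⟩ := exists_roots (M 0 0 + M 1 1) (M 0 0 * M 1 1 - M 0 1 * M 1 0) (by
    rw [h00, h01, h10, h11]
    have : 0 < α * β * (x * s) * (y * q) := by positivity
    nlinarith [sq_nonneg (α * (x * p) - β * (y * t))])
  refine ⟨a, b, hab, ?_, ?_, ?_, ?_, ?_⟩
  · rw [hsum, h00, h11]
    nlinarith [mul_lt_mul_of_pos_right hα1 hxp, mul_lt_mul_of_pos_right hβ1 hyt]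
  · rw [hsum, h00, h11]
    nlinarith [mul_pos hα hxp, mul_pos hβ hyt]
  · rw [hprod, h00, h01, h10, h11]
    have k1 : 1 - α * (x * p) = (1 - α) + α * (y * q) := by linear_combination (-α) * e1
    have k2 : 1 - β * (y * t) = (1 - β) + β * (x * s) := by linear_combination (-β) * e2
    rw [k1, k2]
    have a1 : 0 < (1 - α) * (1 - β) := mul_pos (by linarith) (by linarith)
    have a2 : 0 < (1 - α) * (β * (x * s)) := mul_pos (by linarith) (by positivity)
    have a3 : 0 < (1 - β) * (α * (y * q)) := mul_pos (by linarith) (by positivity)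
    nlinarith
  · have : (1 - a) * (1 - b) = 1 - (a + b) + a * b := by ring
    rw [this, hsum, hprod, h00, h01, h10, h11]
    linear_combination α * β * y * t * e1 - α * β * y * q * e2
  · rw [Matrix.charpoly_fin_two, Matrix.trace_fin_two, Matrix.det_fin_two, ← hsum, ← hprod]
    simp only [map_add, map_mul]
    ring

/-- For T ∈ DCS(3,f) and distinct indices i, j, k:
if γⱼₖγₖⱼ > 0 there is exactly one fixed point in the interior of the
coordinate plane πᵢ, if γⱼₖγₖⱼ < 0 there is none; and at such a fixed point
the Jacobian of the restriction T|πᵢ (the (j,k)-submatrix of DT) has one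
eigenvalue in (0,1) and one > 1 when γⱼₖ, γₖⱼ < 0, while both eigenvalues lie
in (0,1) when γⱼₖ, γₖⱼ > 0. -/
theorem stmt15 (fam : Fin 3 → GrowthF) (r : Fin 3 → ℝ) (μ : Fin 3 → Fin 3 → ℝ)
    (hr : ∀ i, 0 < r i) (hμ : ∀ i j, 0 < μ i j)
    (i j k : Fin 3) (hij : i ≠ j) (hik : i ≠ k) (hjk : j ≠ k) :
    (0 < (μ j j - μ k j) * (μ k k - μ j k) →
      ∃! v : Fin 3 → ℝ, (v i = 0 ∧ 0 < v j ∧ 0 < v k) ∧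
        DCS.map fam r μ v = v) ∧
    ((μ j j - μ k j) * (μ k k - μ j k) < 0 →
      ∀ v : Fin 3 → ℝ, v i = 0 → 0 < v j → 0 < v k →
        DCS.map fam r μ v ≠ v) ∧
    (∀ v : Fin 3 → ℝ, v i = 0 → 0 < v j → 0 < v k → DCS.map fam r μ v = v →
      ((μ j j - μ k j < 0 → μ k k - μ j k < 0 →
        ∃ a b : ℝ, 0 < a ∧ a < 1 ∧ 1 < b ∧
          ((DCS.jac fam r μ v).submatrix ![j, k] ![j, k]).charpoly
            = (X - C a) * (X - C b)) ∧
       (0 < μ j j - μ k j → 0 < μ k k - μ j k →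
        ∃ a b : ℝ, 0 < a ∧ a < 1 ∧ 0 < b ∧ b < 1 ∧
          ((DCS.jac fam r μ v).submatrix ![j, k] ![j, k]).charpoly
            = (X - C a) * (X - C b)))) := by
  have fx := fixed_iff fam r μ hr hμ i j k hij hik hjk
  refine ⟨?_, ?_, ?_⟩
  · intro h
    obtain ⟨x, y, hx, hy, e1, e2, hu⟩ : ∃ x y : ℝ, 0 < x ∧ 0 < y ∧
        μ j j * x + μ j k * y = 1 ∧ μ k j * x + μ k k * y = 1 ∧
        ∀ x' y' : ℝ, μ j j * x' + μ j k * y' = 1 → μ k j * x' + μ k k * y' = 1 →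
          x' = x ∧ y' = y := by
      have a1 := hμ j j
      have a2 := hμ j k
      have a3 := hμ k j
      have a4 := hμ k k
      generalize μ j j = p at *
      generalize μ j k = q at *
      generalize μ k j = s at *
      generalize μ k k = t at *
      have hD : p * t - q * s ≠ 0 ∧ 0 < (t - q) / (p * t - q * s) ∧
          0 < (p - s) / (p * t - q * s) := by
        rcases mul_pos_iff.1 h with ⟨b1, b2⟩ | ⟨b1, b2⟩
        · have : 0 < p * t - q * s := by nlinarith
          exact ⟨this.ne', div_pos b2 this, div_pos b1 this⟩
        · have : p * t - q * s < 0 := by nlinarith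
          exact ⟨this.ne, div_pos_of_neg_of_neg b2 this, div_pos_of_neg_of_neg b1 this⟩
      obtain ⟨hD, hx, hy⟩ := hD
      refine ⟨_, _, hx, hy, ?_, ?_, ?_⟩
      · rw [mul_div_assoc', mul_div_assoc', ← add_div, div_eq_one_iff_eq hD]; ring
      · rw [mul_div_assoc', mul_div_assoc', ← add_div, div_eq_one_iff_eq hD]; ring
      · intro x' y' e1 e2
        rw [eq_div_iff hD, eq_div_iff hD]
        constructor
        · linear_combination t * e1 - q * e2
        · linear_combination p * e2 - s * e1
    have vj : (fun l => if l = j then x else if l = k then y else 0 : Fin 3 → ℝ) j = x := by simp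
    have vk : (fun l => if l = j then x else if l = k then y else 0 : Fin 3 → ℝ) k = y := by
      simp [hjk.symm]
    have vi : (fun l => if l = j then x else if l = k then y else 0 : Fin 3 → ℝ) i = 0 := by
      simp [hij, hik]
    generalize (fun l => if l = j then x else if l = k then y else 0 : Fin 3 → ℝ) = v at *
    subst vj vk
    refine ⟨v, ⟨⟨vi, hx, hy⟩, (fx v vi hx hy).2 ⟨e1, e2⟩⟩, ?_⟩
    rintro w ⟨⟨wi, wj, wk⟩, hw⟩
    obtain ⟨c1, c2⟩ := (fx w wi wj wk).1 hw
    obtain ⟨d1, d2⟩ := hu _ _ c1 c2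
    funext m
    have hm : m = i ∨ m = j ∨ m = k := by
      clear * - hij hik hjk
      revert i j k m; decide
    rcases hm with rfl | rfl | rfl
    · rw [wi, vi]
    · exact d1
    · exact d2
  · intro h v vi vj vk hv
    obtain ⟨e1, e2⟩ := (fx v vi vj vk).1 hv
    have e : (μ j j - μ k j) * v j = (μ k k - μ j k) * v k := by linear_combination e1 - e2
    rcases mul_neg_iff.1 h with ⟨b1, b2⟩ | ⟨b1, b2⟩
    · nlinarith [mul_pos b1 vj, mul_pos (neg_pos.2 b2) vk]
    · nlinarith [mul_pos (neg_pos.2 b1) vj, mul_pos b2 vk]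
  · intro v vi vj vk hv
    obtain ⟨e1, e2⟩ := (fx v vi vj vk).1 hv
    have hs : ∀ m, ∑ l, μ m l * v l = μ m j * v j + μ m k * v k := by
      intro m
      rw [sum_three i j k hij hik hjk, vi]; ring
    have hα : ∀ m, 0 < -(r m * (fam m).fz (r m) (r m)) ∧
        -(r m * (fam m).fz (r m) (r m)) < 1 := by
      intro m
      have h1 := (fam m).contest (r m) (r m) (hr m).le (hr m)
      rw [(fam m).unit _ (hr m)] at h1
      have h2 := (fam m).fz_neg (r m) (r m) (hr m).le (hr m)
      exact ⟨neg_pos.2 (mul_neg_of_pos_of_neg (hr m) h2), by linarith⟩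
    obtain ⟨a, b, hab, h0, h2, hpr, h1, hc⟩ := eig_aux
      ((DCS.jac fam r μ v).submatrix ![j, k] ![j, k]) (μ j j) (μ j k) (μ k j) (μ k k) (v j) (v k)
      _ _ (hμ _ _) (hμ _ _) (hμ _ _) (hμ _ _) vj vk (hα j).1 (hα j).2 (hα k).1 (hα k).2 e1 e2
      (by simp [DCS.jac, DCS.F, hs, e1, (fam j).unit _ (hr j)]; ring)
      (by simp [DCS.jac, hs, e1, hjk]; ring)
      (by simp [DCS.jac, hs, e2, hjk.symm]; ring)
      (by simp [DCS.jac, DCS.F, hs, e2, (fam k).unit _ (hr k)]; ring)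
    have hpos : 0 < -(r j * (fam j).fz (r j) (r j)) * -(r k * (fam k).fz (r k) (r k)) * v k :=
      mul_pos (mul_pos (hα j).1 (hα k).1) vk
    have ha : 0 < a := by
      by_contra hn
      have hb : 0 < b := by linarith
      nlinarith
    constructor
    · intro _ g2
      have hneg := mul_neg_of_pos_of_neg hpos g2
      rw [← h1] at hneg
      rcases mul_neg_iff.1 hneg with ⟨b1, b2⟩ | ⟨b1, b2⟩
      · exact ⟨a, b, ha, by linarith, by linarith, hc⟩
      · linarith
    · intro _ g2
      have hp := mul_pos hpos g2
      rw [← h1] at hp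
      rcases mul_pos_iff.1 hp with ⟨b1, b2⟩ | ⟨b1, b2⟩
      · exact ⟨a, b, ha, by linarith, by linarith, by linarith, hc⟩
      · linarith
end
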